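/- arXiv:math/0702849 — 9 statements merged into one kernel-verified Lean document; each statement's English description precedes it below -/
import Mathlib

section
/- Let (K_n) be a large financial market with numéraire portfolios (V_n) as in the context. Then the following five conditions are equivalent: (a) NAA holds; (b) for every sequence ξ_n ∈ K_n the sequence (ξ_n | P_n) is tight; (c) the sequence (V_n | P_n) is tight; (d) (P_n) ◁ ((V_n)^{-1}·P_n); (e) there exists a sequence ζ_n ∈ D_n such that (P_n) ◁ (ζ_n·P_n). -/
open MeasureTheory Filter Topology ENNReal

/-- The sequence of nonnegative random variables `(ξ n | P n)` is tight:
`lim_{M→∞} limsup_{n→∞} P_n(ξ_n ≥ M) = 0`. -/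
def Tight {Ω : ℕ → Type*} [∀ n, MeasurableSpace (Ω n)]
    (P : ∀ n, Measure (Ω n)) (ξ : ∀ n, Ω n → ℝ) : Prop :=
  Tendsto (fun M : ℝ => limsup (fun n => P n {ω | M ≤ ξ n ω}) atTop) atTop (𝓝 0)

/-- `(P n)` is contiguous with respect to the sequence of (sub-probability) measures `(Q n)`. -/
def Contig {Ω : ℕ → Type*} [∀ n, MeasurableSpace (Ω n)]
    (P Q : ∀ n, Measure (Ω n)) : Prop :=
  ∀ A : ∀ n, Set (Ω n), (∀ n, MeasurableSet (A n)) →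
    Tendsto (fun n => Q n (A n)) atTop (𝓝 0) →
    Tendsto (fun n => P n (A n)) atTop (𝓝 0)

/-- `ζ` is an equivalent supermartingale density for the market `K` under `P`:
`ζ` is measurable, `ζ > 0` a.s. and `E[ζ·ξ] ≤ 1` for every `ξ ∈ K`. -/
def IsESD {Ω' : Type*} [MeasurableSpace Ω'] (P : Measure Ω')
    (K : Set (Ω' → ℝ)) (ζ : Ω' → ℝ) : Prop :=
  Measurable ζ ∧ (∀ᵐ ω ∂P, 0 < ζ ω) ∧
    ∀ ξ ∈ K, ∫⁻ ω, ENNReal.ofReal (ζ ω * ξ ω) ∂P ≤ 1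

/-- No asymptotic arbitrage for the large market `(K n)`. -/
def NAA {Ω : ℕ → Type*} [∀ n, MeasurableSpace (Ω n)]
    (P : ∀ n, Measure (Ω n)) (K : ∀ n, Set (Ω n → ℝ)) : Prop :=
  ∀ ξ : ∀ n, Ω n → ℝ, (∀ n, ξ n ∈ K n) →
    ∀ lam : ℕ → ℝ, (∀ n, 0 ≤ lam n) → Tendsto lam atTop (𝓝 (0 : ℝ)) →
      limsup (fun n => P n {ω | 1 ≤ lam n * ξ n ω}) atTop = 0

/-- If no vanishing nonnegative scaling of `ξ` exceeds `1` with asymptotically positive probability,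
then `ξ` is tight. -/
theorem tight_of_forall_limsup_eq_zero {Ω : ℕ → Type*} [∀ n, MeasurableSpace (Ω n)]
    {P : ∀ n, Measure (Ω n)} {ξ : ∀ n, Ω n → ℝ}
    (h : ∀ lam : ℕ → ℝ, (∀ n, 0 ≤ lam n) → Tendsto lam atTop (𝓝 (0 : ℝ)) →
      limsup (fun n => P n {ω | 1 ≤ lam n * ξ n ω}) atTop = 0) :
    Tight P ξ := by
  have hanti : Antitone (fun M : ℝ => limsup (fun n => P n {ω | M ≤ ξ n ω}) atTop) := by
    intro a b hab
    refine limsup_le_limsup (Eventually.of_forall fun n => ?_)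
    exact measure_mono fun ω (hω : b ≤ ξ n ω) => hab.trans hω
  rw [Tight, ENNReal.tendsto_nhds_zero]
  intro ε hε
  by_contra hcon
  have hlt : ∀ M : ℝ, ε < limsup (fun n => P n {ω | M ≤ ξ n ω}) atTop := by
    intro M
    by_contra hM
    refine hcon ?_
    filter_upwards [eventually_ge_atTop M] with x hx
    exact (hanti hx).trans (not_lt.1 hM)
  obtain ⟨φ, hφ, hφε⟩ := extraction_forall_of_frequently
    (P := fun k n => ε < P n {ω | ((k : ℝ) + 1) ≤ ξ n ω})
    fun k => frequently_lt_of_lt_limsup (by isBoundedDefault) (hlt ((k : ℝ) + 1))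
  let lam : ℕ → ℝ := Function.extend φ (fun k : ℕ => 1 / ((k : ℝ) + 1)) 0
  have hlamφ : ∀ k, lam (φ k) = 1 / ((k : ℝ) + 1) := fun k => hφ.injective.extend_apply _ _ k
  have hlam0 : ∀ n, (¬∃ k, φ k = n) → lam n = 0 := fun n hn =>
    Function.extend_apply' _ _ _ hn
  have hlam_nonneg : ∀ n, 0 ≤ lam n := by
    intro n
    by_cases hn : ∃ k, φ k = n
    · obtain ⟨k, rfl⟩ := hn
      rw [hlamφ]
      positivity
    · exact (hlam0 n hn).ge
  have hlam_lim : Tendsto lam atTop (𝓝 0) := by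
    refine tendsto_order.2 ⟨fun a ha => Eventually.of_forall fun n => ha.trans_le (hlam_nonneg n),
      fun a ha => ?_⟩
    obtain ⟨k₀, hk₀⟩ := exists_nat_one_div_lt ha
    filter_upwards [eventually_ge_atTop (φ k₀)] with n hn
    by_cases hex : ∃ k, φ k = n
    · obtain ⟨k, rfl⟩ := hex
      rw [hlamφ]
      exact (Nat.one_div_le_one_div (hφ.le_iff_le.1 hn)).trans_lt hk₀
    · exact (hlam0 n hex).trans_lt ha
  have hfreq : ∃ᶠ n in atTop, ε ≤ P n {ω | 1 ≤ lam n * ξ n ω} := by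
    refine hφ.tendsto_atTop.frequently (Frequently.of_forall fun k => ?_)
    refine (hφε k).le.trans (measure_mono fun ω (hω : (k : ℝ) + 1 ≤ ξ (φ k) ω) => ?_)
    have hk : (0 : ℝ) < (k : ℝ) + 1 := by positivity
    change 1 ≤ lam (φ k) * ξ (φ k) ω
    rwa [hlamφ, one_div_mul_eq_div, one_le_div hk]
  have hle := le_limsup_of_frequently_le hfreq (by isBoundedDefault)
  rw [h lam hlam_nonneg hlam_lim] at hle
  exact absurd hle (not_le.2 hε)

/-- A set on which `V < M` has measure at most `M` times its mass under the density `V⁻¹`. -/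
theorem measure_le_measure_ge_add_mul_withDensity_inv {Ω : Type*} [MeasurableSpace Ω]
    {P : Measure Ω} {V : Ω → ℝ} (hV : Measurable V) (hpos : ∀ᵐ ω ∂P, 0 < V ω)
    {A : Set Ω} (hA : MeasurableSet A) (M : ℝ) :
    P A ≤ P {ω | M ≤ V ω} +
      ENNReal.ofReal M * P.withDensity (fun ω => ENNReal.ofReal (V ω)⁻¹) A := by
  have hmeas : Measurable fun ω => ENNReal.ofReal (V ω)⁻¹ := hV.inv.ennreal_ofReal
  have hS : MeasurableSet {ω | M ≤ V ω} := measurableSet_le measurable_const hV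
  have hdiff : P (A \ {ω | M ≤ V ω}) ≤
      ENNReal.ofReal M * P.withDensity (fun ω => ENNReal.ofReal (V ω)⁻¹) A := by
    calc P (A \ {ω | M ≤ V ω}) = ∫⁻ _ in A \ {ω | M ≤ V ω}, 1 ∂P := by simp
      _ ≤ ∫⁻ ω in A \ {ω | M ≤ V ω}, ENNReal.ofReal M * ENNReal.ofReal (V ω)⁻¹ ∂P := by
        refine lintegral_mono_ae ?_
        filter_upwards [ae_restrict_of_ae hpos, ae_restrict_mem (hA.diff hS)] with ω hω hωM
        have hlt : V ω < M := not_le.1 hωM.2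
        rw [← ENNReal.ofReal_mul (hω.trans hlt).le, ← div_eq_mul_inv, ENNReal.one_le_ofReal,
          one_le_div hω]
        exact hlt.le
      _ ≤ ∫⁻ ω in A, ENNReal.ofReal M * ENNReal.ofReal (V ω)⁻¹ ∂P :=
        lintegral_mono_set Set.sdiff_subset
      _ = _ := by rw [lintegral_const_mul _ hmeas, withDensity_apply _ hA]
  calc P A ≤ P ({ω | M ≤ V ω} ∪ (A \ {ω | M ≤ V ω})) := measure_mono (by simp)
    _ ≤ P {ω | M ≤ V ω} + P (A \ {ω | M ≤ V ω}) := measure_union_le _ _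
    _ ≤ _ := by gcongr

/-- Tightness of positive random variables `V n` makes `P n` contiguous with respect to the
measures with densities `(V n)⁻¹`. -/
theorem Tight.contig_withDensity_inv {Ω : ℕ → Type*} [∀ n, MeasurableSpace (Ω n)]
    {P : ∀ n, Measure (Ω n)} {V : ∀ n, Ω n → ℝ} (hV : ∀ n, Measurable (V n))
    (hpos : ∀ n, ∀ᵐ ω ∂P n, 0 < V n ω) (ht : Tight P V) :
    Contig P (fun n => (P n).withDensity fun ω => ENNReal.ofReal (V n ω)⁻¹) := by
  intro A hA hQ
  rw [ENNReal.tendsto_nhds_zero]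
  intro ε hε
  obtain ⟨M, hM⟩ := (ht.eventually_lt_const (ENNReal.half_pos hε.ne')).exists
  have hlim := ENNReal.Tendsto.const_mul (a := ENNReal.ofReal M) hQ (Or.inr ENNReal.ofReal_ne_top)
  rw [mul_zero] at hlim
  filter_upwards [eventually_lt_of_limsup_lt hM (by isBoundedDefault),
    hlim.eventually_lt_const (ENNReal.half_pos hε.ne')] with n hn hQn
  calc P n (A n) ≤ _ := measure_le_measure_ge_add_mul_withDensity_inv (hV n) (hpos n) (hA n) M
    _ ≤ ε / 2 + ε / 2 := add_le_add hn.le hQn.le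
    _ = ε := ENNReal.add_halves ε

/-- Markov's inequality for a supermartingale density. -/
theorem IsESD.withDensity_one_le_mul_le {Ω : Type*} [MeasurableSpace Ω] {P : Measure Ω}
    {K : Set (Ω → ℝ)} {ζ ξ : Ω → ℝ} (hζ : IsESD P K ζ) (hξK : ξ ∈ K) (hξ : Measurable ξ)
    {c : ℝ} (hc : 0 ≤ c) :
    P.withDensity (fun ω => ENNReal.ofReal (ζ ω)) {ω | 1 ≤ c * ξ ω} ≤ ENNReal.ofReal c := by
  have hS : MeasurableSet {ω | 1 ≤ c * ξ ω} :=
    measurableSet_le measurable_const (hξ.const_mul c)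
  rw [withDensity_apply _ hS]
  calc ∫⁻ ω in {ω | 1 ≤ c * ξ ω}, ENNReal.ofReal (ζ ω) ∂P
      ≤ ∫⁻ ω in {ω | 1 ≤ c * ξ ω}, ENNReal.ofReal c * ENNReal.ofReal (ζ ω * ξ ω) ∂P := by
        refine lintegral_mono_ae ?_
        filter_upwards [ae_restrict_of_ae hζ.2.1, ae_restrict_mem hS] with ω hω hωS
        rw [← ENNReal.ofReal_mul hc, mul_left_comm]
        exact ENNReal.ofReal_le_ofReal (le_mul_of_one_le_right hω.le hωS)
    _ ≤ ∫⁻ ω, ENNReal.ofReal c * ENNReal.ofReal (ζ ω * ξ ω) ∂P := setLIntegral_le_lintegral _ _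
    _ = ENNReal.ofReal c * ∫⁻ ω, ENNReal.ofReal (ζ ω * ξ ω) ∂P :=
        lintegral_const_mul _ (hζ.1.mul hξ).ennreal_ofReal
    _ ≤ ENNReal.ofReal c * 1 := by gcongr; exact hζ.2.2 ξ hξK
    _ = ENNReal.ofReal c := mul_one _

/-- Theorem 1: in a large market `(K n)` with numéraire portfolios `(V n)`, the conditions
(a) NAA, (b) tightness of every `(ξ_n | P_n)` with `ξ_n ∈ K_n`, (c) tightness of
`(V_n | P_n)`, (d) `(P_n) ◁ ((V_n)⁻¹·P_n)`, (e) `(P_n) ◁ (ζ_n·P_n)` for some sequence of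
equivalent supermartingale densities `ζ_n`, are all equivalent. -/
theorem naa_tfae {Ω : ℕ → Type*} [∀ n, MeasurableSpace (Ω n)]
    (P : ∀ n, Measure (Ω n)) (hP : ∀ n, IsProbabilityMeasure (P n))
    (K : ∀ n, Set (Ω n → ℝ))
    (hKmeas : ∀ n, ∀ ξ ∈ K n, Measurable ξ)
    (hKnonneg : ∀ n, ∀ ξ ∈ K n, ∀ ω, 0 ≤ ξ ω)
    (hK1 : ∀ n, (fun _ => (1 : ℝ)) ∈ K n)
    (V : ∀ n, Ω n → ℝ) (hVK : ∀ n, V n ∈ K n)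
    (hVpos : ∀ n, ∀ᵐ ω ∂P n, 0 < V n ω)
    (hVnum : ∀ n, ∀ ξ ∈ K n, ∫⁻ ω, ENNReal.ofReal (ξ ω / V n ω) ∂P n ≤ 1) :
    List.TFAE [
      NAA P K,
      ∀ ξ : ∀ n, Ω n → ℝ, (∀ n, ξ n ∈ K n) → Tight P ξ,
      Tight P V,
      Contig P (fun n => (P n).withDensity fun ω => ENNReal.ofReal (V n ω)⁻¹),
      ∃ ζ : ∀ n, Ω n → ℝ, (∀ n, IsESD (P n) (K n) (ζ n)) ∧
        Contig P (fun n => (P n).withDensity fun ω => ENNReal.ofReal (ζ n ω))] := by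
  tfae_have 1 → 2 := fun h ξ hξ => tight_of_forall_limsup_eq_zero (h ξ hξ)
  tfae_have 2 → 3 := fun h => h V hVK
  tfae_have 3 → 4 := fun h => h.contig_withDensity_inv (fun n => hKmeas n _ (hVK n)) hVpos
  tfae_have 4 → 5 := by
    refine fun h => ⟨fun n ω => (V n ω)⁻¹, fun n => ⟨(hKmeas n _ (hVK n)).inv, ?_, ?_⟩, h⟩
    · filter_upwards [hVpos n] with ω hω using inv_pos.2 hω
    · intro ξ hξ
      simpa only [div_eq_inv_mul] using hVnum n ξ hξ
  tfae_have 5 → 1 := by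
    rintro ⟨ζ, hζ, hcontig⟩ ξ hξ lam hlam hlam_lim
    have hmeas : ∀ n, MeasurableSet {ω | 1 ≤ lam n * ξ n ω} := fun n =>
      measurableSet_le measurable_const ((hKmeas n _ (hξ n)).const_mul _)
    have hlim : Tendsto (fun n => ENNReal.ofReal (lam n)) atTop (𝓝 0) := by
      simpa using ENNReal.tendsto_ofReal hlam_lim
    exact (hcontig _ hmeas (tendsto_of_tendsto_of_tendsto_of_le_of_le tendsto_const_nhds hlim
      (fun _ => zero_le) fun n => (hζ n).withDensity_one_le_mul_le (hξ n)
        (hKmeas n _ (hξ n)) (hlam n))).limsup_eq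
  tfae_finish
end

section
/- Let (K_n) be a large financial market with numéraire portfolios (V_n) as in the context. Then the following five conditions are equivalent: (a) SAA holds; (b) there exists a sequence ξ_n ∈ K_n such that lim sup_{n→∞} P_n(ξ_n ≥ M) = 1 for every M > 0; (c) lim sup_{n→∞} P_n(V_n ≥ M) = 1 for every M > 0; (d) (P_n) △ ((V_n)^{-1}·P_n); (e) (P_n) △ (ζ_n·P_n) for every sequence ζ_n ∈ D_n. -/
open MeasureTheory Filter Topology ENNReal

/-- The sequences `(P n)` (probability measures) and `(Q n)` (sub-probability measures)
are entirely (asymptotically) separated. -/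
def EntSep {Ω : ℕ → Type*} [∀ n, MeasurableSpace (Ω n)]
    (P Q : ∀ n, Measure (Ω n)) : Prop :=
  ∃ φ : ℕ → ℕ, StrictMono φ ∧
    ∃ A : ∀ k, Set (Ω (φ k)), (∀ k, MeasurableSet (A k)) ∧
      Tendsto (fun k => P (φ k) (A k)) atTop (𝓝 1) ∧
      Tendsto (fun k => Q (φ k) (A k)) atTop (𝓝 0)

/-- Strong asymptotic arbitrage for the large market `(K n)`. -/
def SAA {Ω : ℕ → Type*} [∀ n, MeasurableSpace (Ω n)]
    (P : ∀ n, Measure (Ω n)) (K : ∀ n, Set (Ω n → ℝ)) : Prop :=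
  ∃ (ξ : ∀ n, Ω n → ℝ) (lam : ℕ → ℝ), (∀ n, ξ n ∈ K n) ∧ (∀ n, 0 ≤ lam n) ∧
    Tendsto lam atTop (𝓝 (0 : ℝ)) ∧
    limsup (fun n => P n {ω | 1 ≤ lam n * ξ n ω}) atTop = 1

theorem limsup_measure_eq_one_of_subseq {Ω : ℕ → Type*} [∀ n, MeasurableSpace (Ω n)]
    {P : ∀ n, Measure (Ω n)} (hP : ∀ n, IsProbabilityMeasure (P n))
    {s : ∀ n, Set (Ω n)} {φ : ℕ → ℕ} (hφ : StrictMono φ) {a b : ℕ → ℝ≥0∞}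
    (ha : Tendsto a atTop (𝓝 1)) (hb : Tendsto b atTop (𝓝 0))
    (hab : ∀ k, a k ≤ P (φ k) (s (φ k)) + b k) :
    limsup (fun n => P n (s n)) atTop = 1 := by
  refine le_antisymm ?_ ?_
  · exact limsup_le_of_le (h := Eventually.of_forall fun n => prob_le_one)
  · have hsub : Tendsto (fun k => a k - b k) atTop (𝓝 1) := by
      simpa using ENNReal.Tendsto.sub ha hb (Or.inl one_ne_top)
    have hlim : Tendsto (fun k => P (φ k) (s (φ k))) atTop (𝓝 1) :=
      tendsto_of_tendsto_of_tendsto_of_le_of_le hsub tendsto_const_nhds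
        (fun k => tsub_le_iff_right.2 (hab k)) (fun k => prob_le_one)
    calc (1 : ℝ≥0∞) = limsup ((fun n => P n (s n)) ∘ φ) atTop := hlim.limsup_eq.symm
      _ = limsup (fun n => P n (s n)) (map φ atTop) := rfl
      _ ≤ limsup (fun n => P n (s n)) atTop := limsup_le_limsup_of_le hφ.tendsto_atTop

/-- A diagonal extraction: unboundedness in probability along the limsup yields a single
subsequence along which the levels tend to infinity. -/
theorem exists_subseq_tendsto_measure_ge {Ω : ℕ → Type*} [∀ n, MeasurableSpace (Ω n)]
    {P : ∀ n, Measure (Ω n)} (hP : ∀ n, IsProbabilityMeasure (P n)) {ξ : ∀ n, Ω n → ℝ}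
    (h : ∀ M : ℝ, 0 < M → limsup (fun n => P n {ω | M ≤ ξ n ω}) atTop = 1) :
    ∃ φ : ℕ → ℕ, StrictMono φ ∧
      Tendsto (fun k => P (φ k) {ω | (k + 1 : ℝ) ≤ ξ (φ k) ω}) atTop (𝓝 1) := by
  have hfreq (k : ℕ) : ∃ᶠ n in atTop,
      1 - ((k + 1 : ℕ) : ℝ≥0∞)⁻¹ < P n {ω | (k + 1 : ℝ) ≤ ξ n ω} := by
    refine frequently_lt_of_lt_limsup (by isBoundedDefault) ?_
    rw [h _ (by positivity)]
    exact ENNReal.sub_lt_self one_ne_top one_ne_zero (by simp)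
  obtain ⟨φ, hφ, hlt⟩ := extraction_forall_of_frequently hfreq
  refine ⟨φ, hφ, tendsto_of_tendsto_of_tendsto_of_le_of_le ?_ tendsto_const_nhds
    (fun k => (hlt k).le) (fun k => prob_le_one)⟩
  simpa using ENNReal.Tendsto.sub tendsto_const_nhds
    (ENNReal.tendsto_inv_nat_nhds_zero.comp (tendsto_add_atTop_nat 1)) (Or.inl one_ne_top)

theorem tendsto_inv_ofReal_natCast_add_one_div {M : ℝ} (hM : 0 < M) :
    Tendsto (fun k : ℕ => (ENNReal.ofReal ((k + 1) / M))⁻¹) atTop (𝓝 0) := by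
  rw [← ENNReal.inv_top]
  refine Tendsto.inv (ENNReal.tendsto_ofReal_atTop.comp ?_)
  exact (tendsto_atTop_add_const_right _ _ tendsto_natCast_atTop_atTop).atTop_div_const hM

theorem measure_ge_le_of_lintegral_div_le_one {Ω : Type*} [MeasurableSpace Ω] {P : Measure Ω}
    {ξ V : Ω → ℝ} (hξ : Measurable ξ) (hV : Measurable V) (hVpos : ∀ᵐ ω ∂P, 0 < V ω)
    (h : ∫⁻ ω, ENNReal.ofReal (ξ ω / V ω) ∂P ≤ 1) {M c : ℝ} (hc : 0 < c) :
    P {ω | c ≤ ξ ω} ≤ P {ω | M ≤ V ω} + (ENNReal.ofReal (c / M))⁻¹ := by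
  have hmarkov : P {ω | ENNReal.ofReal (c / M) ≤ ENNReal.ofReal (ξ ω / V ω)} ≤
      (ENNReal.ofReal (c / M))⁻¹ := by
    rw [ENNReal.le_inv_iff_mul_le, mul_comm]
    exact (mul_meas_ge_le_lintegral (hξ.div hV).ennreal_ofReal _).trans h
  calc P {ω | c ≤ ξ ω}
      ≤ P ({ω | M ≤ V ω} ∪ {ω | ENNReal.ofReal (c / M) ≤ ENNReal.ofReal (ξ ω / V ω)}) := by
        refine measure_mono_ae ?_
        filter_upwards [hVpos] with ω hω (hcω : c ≤ ξ ω)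
        rcases le_or_gt M (V ω) with hMV | hMV
        · exact Or.inl hMV
        · exact Or.inr (ENNReal.ofReal_le_ofReal
            (div_le_div₀ (hc.le.trans hcω) hcω hω hMV.le))
    _ ≤ _ := (measure_union_le _ _).trans (by gcongr)

theorem measure_le_add_withDensity_inv {Ω : Type*} [MeasurableSpace Ω] {P : Measure Ω}
    {V : Ω → ℝ} (hV : Measurable V) (hVpos : ∀ᵐ ω ∂P, 0 < V ω) {A : Set Ω}
    (hA : MeasurableSet A) {M : ℝ} :
    P A ≤ P {ω | M ≤ V ω} +
      ENNReal.ofReal M * P.withDensity (fun ω => ENNReal.ofReal (V ω)⁻¹) A := by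
  have hB : MeasurableSet (A \ {ω | M ≤ V ω}) := hA.diff (measurableSet_le measurable_const hV)
  calc P A ≤ P {ω | M ≤ V ω} + P (A \ {ω | M ≤ V ω}) := by
        refine (measure_mono ?_).trans (measure_union_le _ _)
        rw [Set.union_sdiff_self]
        exact Set.subset_union_right
    _ ≤ P {ω | M ≤ V ω} + ENNReal.ofReal M *
          P.withDensity (fun ω => ENNReal.ofReal (V ω)⁻¹) (A \ {ω | M ≤ V ω}) := by
        gcongr
        rw [withDensity_apply _ hB, ← lintegral_const_mul _ (by fun_prop),
          ← setLIntegral_one]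
        refine setLIntegral_mono_ae (by fun_prop) ?_
        filter_upwards [hVpos] with ω hω hωB
        have hlt : V ω < M := not_le.1 hωB.2
        rw [← ENNReal.ofReal_mul (hω.trans hlt).le, ← ENNReal.ofReal_one,
          ← div_eq_mul_inv]
        exact ENNReal.ofReal_le_ofReal ((one_le_div hω).2 hlt.le)
    _ ≤ _ := by gcongr; exact Set.sdiff_subset

theorem withDensity_ge_le_of_lintegral_mul_le_one {Ω : Type*} [MeasurableSpace Ω]
    {P : Measure Ω} {V ζ : Ω → ℝ} (hV : Measurable V) (hζ : Measurable ζ)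
    (hζpos : ∀ᵐ ω ∂P, 0 < ζ ω) (h : ∫⁻ ω, ENNReal.ofReal (ζ ω * V ω) ∂P ≤ 1) {c : ℝ} :
    P.withDensity (fun ω => ENNReal.ofReal (ζ ω)) {ω | c ≤ V ω} ≤ (ENNReal.ofReal c)⁻¹ := by
  have hA : MeasurableSet {ω | c ≤ V ω} := measurableSet_le measurable_const hV
  rw [ENNReal.le_inv_iff_mul_le, withDensity_apply _ hA,
    ← lintegral_mul_const _ hζ.ennreal_ofReal]
  refine le_trans ?_ ((setLIntegral_le_lintegral {ω | c ≤ V ω} _).trans h)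
  refine setLIntegral_mono_ae (by fun_prop) ?_
  filter_upwards [hζpos] with ω hω hωA
  rw [← ENNReal.ofReal_mul hω.le]
  exact ENNReal.ofReal_le_ofReal (mul_le_mul_of_nonneg_left hωA hω.le)

theorem tendsto_extend_zero_of_strictMono {φ : ℕ → ℕ} (hφ : StrictMono φ) {u : ℕ → ℝ}
    (hu : Tendsto u atTop (𝓝 0)) : Tendsto (Function.extend φ u 0) atTop (𝓝 0) := by
  rw [Metric.tendsto_atTop] at hu ⊢
  intro ε hε
  obtain ⟨N, hN⟩ := hu ε hε
  refine ⟨φ N, fun n hn => ?_⟩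
  by_cases hex : ∃ k, φ k = n
  · obtain ⟨k, rfl⟩ := hex
    rw [hφ.injective.extend_apply]
    exact hN k (hφ.le_iff_le.1 hn)
  · rw [Function.extend_apply' _ _ _ hex]
    simpa using hε

/-- Theorem 2: in a large market `(K n)` with numéraire portfolios `(V n)`, the conditions
(a) SAA, (b) existence of `ξ_n ∈ K_n` with `limsup P_n(ξ_n ≥ M) = 1` for all `M > 0`,
(c) `limsup P_n(V_n ≥ M) = 1` for all `M > 0`, (d) `(P_n) △ ((V_n)⁻¹·P_n)`,
(e) `(P_n) △ (ζ_n·P_n)` for every sequence of equivalent supermartingale densities `ζ_n`,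
are all equivalent. -/
theorem saa_tfae {Ω : ℕ → Type*} [∀ n, MeasurableSpace (Ω n)]
    (P : ∀ n, Measure (Ω n)) (hP : ∀ n, IsProbabilityMeasure (P n))
    (K : ∀ n, Set (Ω n → ℝ))
    (hKmeas : ∀ n, ∀ ξ ∈ K n, Measurable ξ)
    (hKnonneg : ∀ n, ∀ ξ ∈ K n, ∀ ω, 0 ≤ ξ ω)
    (hK1 : ∀ n, (fun _ => (1 : ℝ)) ∈ K n)
    (V : ∀ n, Ω n → ℝ) (hVK : ∀ n, V n ∈ K n)
    (hVpos : ∀ n, ∀ᵐ ω ∂P n, 0 < V n ω)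
    (hVnum : ∀ n, ∀ ξ ∈ K n, ∫⁻ ω, ENNReal.ofReal (ξ ω / V n ω) ∂P n ≤ 1) :
    List.TFAE [
      SAA P K,
      ∃ ξ : ∀ n, Ω n → ℝ, (∀ n, ξ n ∈ K n) ∧
        ∀ M : ℝ, 0 < M → limsup (fun n => P n {ω | M ≤ ξ n ω}) atTop = 1,
      ∀ M : ℝ, 0 < M → limsup (fun n => P n {ω | M ≤ V n ω}) atTop = 1,
      EntSep P (fun n => (P n).withDensity fun ω => ENNReal.ofReal (V n ω)⁻¹),
      ∀ ζ : ∀ n, Ω n → ℝ, (∀ n, IsESD (P n) (K n) (ζ n)) →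
        EntSep P (fun n => (P n).withDensity fun ω => ENNReal.ofReal (ζ n ω))] := by
  have hVmeas n : Measurable (V n) := hKmeas n _ (hVK n)
  tfae_have 1 → 2 := by
    rintro ⟨ξ, lam, hξ, -, hlam, hlim⟩
    refine ⟨ξ, hξ, fun M hM => le_antisymm ?_ ?_⟩
    · exact limsup_le_of_le (h := Eventually.of_forall fun n => prob_le_one)
    · rw [← hlim]
      refine limsup_le_limsup ?_
      filter_upwards [hlam.eventually (ge_mem_nhds (inv_pos.2 hM))] with n hn
      refine measure_mono fun ω (hω : 1 ≤ lam n * ξ n ω) => ?_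
      have hle : 1 ≤ M⁻¹ * ξ n ω :=
        hω.trans (mul_le_mul_of_nonneg_right hn (hKnonneg n _ (hξ n) ω))
      rwa [inv_mul_eq_div, one_le_div hM] at hle
  tfae_have 2 → 3 := by
    rintro ⟨ξ, hξ, hlim⟩ M hM
    obtain ⟨φ, hφ, hφlim⟩ := exists_subseq_tendsto_measure_ge hP hlim
    exact limsup_measure_eq_one_of_subseq hP hφ hφlim
      (tendsto_inv_ofReal_natCast_add_one_div hM) fun k =>
        measure_ge_le_of_lintegral_div_le_one (hKmeas _ _ (hξ _)) (hVmeas _) (hVpos _)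
          (hVnum _ _ (hξ _)) (by positivity)
  tfae_have 3 → 1 := by
    intro hlim
    obtain ⟨φ, hφ, hφlim⟩ := exists_subseq_tendsto_measure_ge hP hlim
    refine ⟨V, Function.extend φ (fun k : ℕ => 1 / ((k : ℝ) + 1)) 0, hVK, fun n => ?_,
      tendsto_extend_zero_of_strictMono hφ tendsto_one_div_add_atTop_nhds_zero_nat,
      limsup_measure_eq_one_of_subseq hP hφ hφlim tendsto_const_nhds fun k => ?_⟩
    · by_cases hex : ∃ k, φ k = n
      · obtain ⟨k, rfl⟩ := hex
        rw [hφ.injective.extend_apply]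
        positivity
      · rw [Function.extend_apply' _ _ _ hex, Pi.zero_apply]
    · rw [add_zero, hφ.injective.extend_apply]
      refine measure_mono fun ω (hω : (k + 1 : ℝ) ≤ V (φ k) ω) => ?_
      rwa [Set.mem_ofPred_eq, one_div_mul_eq_div, one_le_div (by positivity)]
  tfae_have 3 → 5 := by
    intro hlim ζ hζ
    obtain ⟨φ, hφ, hφlim⟩ := exists_subseq_tendsto_measure_ge hP hlim
    refine ⟨φ, hφ, _, fun k => measurableSet_le measurable_const (hVmeas _), hφlim, ?_⟩
    refine tendsto_of_tendsto_of_tendsto_of_le_of_le tendsto_const_nhds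
      (tendsto_inv_ofReal_natCast_add_one_div one_pos) (fun k => zero_le) fun k => ?_
    simpa using withDensity_ge_le_of_lintegral_mul_le_one (c := (k + 1 : ℝ)) (hVmeas (φ k))
      (hζ _).1 (hζ _).2.1 ((hζ _).2.2 _ (hVK _))
  tfae_have 5 → 4 := by
    intro h
    refine h (fun n ω => (V n ω)⁻¹) fun n => ⟨(hVmeas n).inv, ?_, fun ξ hξ => ?_⟩
    · filter_upwards [hVpos n] with ω hω using inv_pos.2 hω
    · simpa only [inv_mul_eq_div] using hVnum n ξ hξ
  tfae_have 4 → 3 := by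
    rintro ⟨φ, hφ, A, hA, hPA, hQA⟩ M -
    refine limsup_measure_eq_one_of_subseq hP hφ hPA ?_ fun k =>
      measure_le_add_withDensity_inv (hVmeas _) (hVpos _) (hA k)
    simpa using ENNReal.Tendsto.const_mul hQA (Or.inr ENNReal.ofReal_ne_top)
  tfae_finish
end

section
/- Let Ω be a finite set, P a probability measure on Ω with P({ω}) > 0 for all ω ∈ Ω, 𝔽 = (𝓕_t)_{t=0,…,T} a filtration with 𝓕_0 trivial, and S = (S_t)_{t=0,…,T} an adapted ℝ^d-valued process. Let M be the set of probability measures Q on Ω equivalent to P under which S is an 𝔽-martingale, and assume M ≠ ∅. Then there exists a unique measure Q̂ ∈ M minimizing the reverse relative entropy, i.e. H(P|Q̂) ≤ H(P|Q) for every Q ∈ M. -/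
open MeasureTheory Filter ENNReal

/-- Relative entropy `H(P|Q) = E_P[log (dP/dQ)]` of two (equivalent) probability measures
on a finite set, written via point masses. -/
noncomputable def relEntropy {Ω : Type*} [Fintype Ω] [MeasurableSpace Ω]
    (P Q : Measure Ω) : ℝ :=
  ∑ ω : Ω, (P {ω}).toReal * Real.log ((P {ω}).toReal / (Q {ω}).toReal)

open Set in
/-- A weighted sum of logarithms with positive weights attains its maximum over the strictly
positive points of a compact convex subset of the standard simplex at exactly one point. -/
theorem existsUnique_isMax_sum_mul_log {ι : Type*} [Fintype ι] {K : Set (ι → ℝ)}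
    (hK : IsCompact K) (hKconv : Convex ℝ K) (hKs : K ⊆ stdSimplex ℝ ι)
    {p : ι → ℝ} (hp : ∀ i, 0 < p i) (hne : ∃ q ∈ K, ∀ i, 0 < q i) :
    ∃! q : ι → ℝ, (q ∈ K ∧ ∀ i, 0 < q i) ∧
      ∀ r ∈ K, (∀ i, 0 < r i) → ∑ i, p i * Real.log (r i) ≤ ∑ i, p i * Real.log (q i) := by
  obtain ⟨q₀, hq₀K, hq₀⟩ := hne
  set f : (ι → ℝ) → ℝ := fun q => ∑ i, p i * Real.log (q i) with hf
  set K' : Set (ι → ℝ) := K ∩ ⋂ i, {q | Real.exp (f q₀ / p i) ≤ q i} with hK'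
  have hK'c : IsCompact K' := hK.inter_right <|
    isClosed_iInter fun i => isClosed_le continuous_const (continuous_apply i)
  have hpos : ∀ q ∈ K', ∀ i, 0 < q i := fun q hq i =>
    (Real.exp_pos _).trans_le (mem_iInter.1 hq.2 i)
  have hmem : ∀ q ∈ K, (∀ i, 0 < q i) → f q₀ ≤ f q → q ∈ K' := by
    intro q hq hq0 hle
    refine ⟨hq, mem_iInter.2 fun i => ?_⟩
    have hq1 : ∀ j, q j ≤ 1 := fun j =>
      (hKs hq).2 ▸ Finset.single_le_sum (fun k _ => (hq0 k).le) (Finset.mem_univ j)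
    have hfi : f q ≤ p i * Real.log (q i) := by
      have h := Finset.single_le_sum (s := Finset.univ)
        (f := fun j => -(p j * Real.log (q j)))
        (fun j _ => neg_nonneg.2 <| mul_nonpos_of_nonneg_of_nonpos (hp j).le
          (Real.log_nonpos (hq0 j).le (hq1 j))) (Finset.mem_univ i)
      rw [Finset.sum_neg_distrib] at h
      exact neg_le_neg_iff.1 h
    change Real.exp (f q₀ / p i) ≤ q i
    rw [← Real.le_log_iff_exp_le (hq0 i), div_le_iff₀' (hp i)]
    exact hle.trans hfi
  have hcont : ContinuousOn f K' := continuousOn_finsetSum _ fun i _ =>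
    continuousOn_const.mul
      ((continuous_apply i).continuousOn.log fun q hq => (hpos q hq i).ne')
  have hq₀K' := hmem q₀ hq₀K hq₀ le_rfl
  obtain ⟨q, hqK', hmax⟩ := hK'c.exists_isMaxOn ⟨q₀, hq₀K'⟩ hcont
  have hqmax : ∀ r ∈ K, (∀ i, 0 < r i) → f r ≤ f q := by
    intro r hr hr0
    rcases le_total (f q₀) (f r) with h | h
    · exact hmax (hmem r hr hr0 h)
    · exact h.trans (hmax hq₀K')
  refine ⟨q, ⟨⟨hqK'.1, hpos q hqK'⟩, hqmax⟩, ?_⟩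
  rintro r ⟨⟨hrK, hr0⟩, hrmax⟩
  by_contra hne
  have hq0 := hpos q hqK'
  obtain ⟨j, hj⟩ := Function.ne_iff.1 hne
  have hmK := hKconv hrK hqK'.1 (a := 1 / 2) (b := 1 / 2) (by norm_num) (by norm_num)
    (by norm_num)
  have hm0 : ∀ i, 0 < ((1 / 2 : ℝ) • r + (1 / 2 : ℝ) • q) i := fun i => by
    have := hr0 i
    have := hq0 i
    simp only [Pi.add_apply, Pi.smul_apply, smul_eq_mul]
    positivity
  have hlt : (1 / 2 : ℝ) * f r + (1 / 2 : ℝ) * f q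
      < f ((1 / 2 : ℝ) • r + (1 / 2 : ℝ) • q) := by
    simp only [hf, Finset.mul_sum, ← Finset.sum_add_distrib]
    refine Finset.sum_lt_sum (fun i _ => ?_) ⟨j, Finset.mem_univ j, ?_⟩
    · have h := strictConcaveOn_log_Ioi.concaveOn.2 (hr0 i) (hq0 i)
        (by norm_num : (0 : ℝ) ≤ 1 / 2) (by norm_num : (0 : ℝ) ≤ 1 / 2) (by norm_num)
      have h' := mul_le_mul_of_nonneg_left h (hp i).le
      simp only [Pi.add_apply, Pi.smul_apply, smul_eq_mul] at h' ⊢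
      linarith
    · have h := strictConcaveOn_log_Ioi.2 (hr0 j) (hq0 j) hj
        (by norm_num : (0 : ℝ) < 1 / 2) (by norm_num : (0 : ℝ) < 1 / 2) (by norm_num)
      have h' := mul_lt_mul_of_pos_left h (hp j)
      simp only [Pi.add_apply, Pi.smul_apply, smul_eq_mul] at h' ⊢
      linarith
  have h1 := hqmax _ hmK hm0
  have h2 : f q ≤ f r := hrmax q hqK'.1 hq0
  linarith

/-- For a finite measure on a finite space, being a version of the conditional expectation is a
family of linear conditions on the point masses. -/
theorem condExp_ae_eq_iff_forall_sum {Ω E : Type*} [Fintype Ω] {m m0 : MeasurableSpace Ω}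
    [MeasurableSingletonClass Ω] [NormedAddCommGroup E] [NormedSpace ℝ E] [CompleteSpace E]
    (hm : m ≤ m0) (Q : Measure Ω) [IsFiniteMeasure Q] (f g : Ω → E)
    (hg : StronglyMeasurable[m] g) :
    Q[f | m] =ᵐ[Q] g ↔ ∀ A, MeasurableSet[m] A →
      ∑ ω, Q.real {ω} • A.indicator g ω = ∑ ω, Q.real {ω} • A.indicator f ω := by
  have hset : ∀ (h : Ω → E) (A : Set Ω), MeasurableSet[m] A →
      ∫ ω in A, h ω ∂Q = ∑ ω, Q.real {ω} • A.indicator h ω := fun h A hA => by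
    rw [← integral_indicator (hm A hA), integral_fintype .of_finite]
  constructor
  · intro h A hA
    rw [← hset g A hA, ← hset f A hA, ← setIntegral_condExp (f := f) hm .of_finite hA]
    exact integral_congr_ae (ae_restrict_of_ae (h.mono fun _ h => h.symm))
  · intro h
    refine (ae_eq_condExp_of_forall_setIntegral_eq hm .of_finite
      (fun _ _ _ => Integrable.of_finite.integrableOn) (fun A hA _ => ?_)
      hg.aestronglyMeasurable).symm
    rw [hset g A hA, hset f A hA, h A hA]

theorem measure_eq_of_real_singleton {Ω : Type*} [Countable Ω] [MeasurableSpace Ω]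
    [MeasurableSingletonClass Ω] {μ ν : Measure Ω} [IsFiniteMeasure μ] [IsFiniteMeasure ν]
    (h : ∀ ω, μ.real {ω} = ν.real {ω}) : μ = ν :=
  Measure.ext_of_singleton fun ω =>
    (ENNReal.toReal_eq_toReal_iff' (measure_ne_top _ _) (measure_ne_top _ _)).1 (h ω)

/-- Every point of the standard simplex is the vector of point masses of a probability measure. -/
theorem exists_isProbabilityMeasure_real_singleton {Ω : Type*} [Fintype Ω] [MeasurableSpace Ω]
    [MeasurableSingletonClass Ω] {q : Ω → ℝ} (hq : q ∈ stdSimplex ℝ Ω) :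
    ∃ Q : Measure Ω, IsProbabilityMeasure Q ∧ ∀ ω, Q.real {ω} = q ω := by
  classical
  refine ⟨∑ ω, ENNReal.ofReal (q ω) • Measure.dirac ω, ⟨?_⟩, fun ω => ?_⟩
  · simp [← ENNReal.ofReal_sum_of_nonneg fun i _ => hq.1 i, hq.2]
  · simp [Measure.real, Set.indicator_apply, hq.1 ω]

theorem relEntropy_eq_sub {Ω : Type*} [Fintype Ω] [MeasurableSpace Ω] {P Q : Measure Ω}
    (hP : ∀ ω, 0 < P.real {ω}) (hQ : ∀ ω, 0 < Q.real {ω}) :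
    relEntropy P Q = ∑ ω, P.real {ω} * Real.log (P.real {ω})
      - ∑ ω, P.real {ω} * Real.log (Q.real {ω}) := by
  rw [← Finset.sum_sub_distrib]
  refine Finset.sum_congr rfl fun ω _ => ?_
  rw [← mul_sub, ← Real.log_div (hP ω).ne' (hQ ω).ne']
  rfl


/-- Theorem 5 (existence/uniqueness part): on a finite probability space carrying an
adapted process `S` admitting at least one equivalent martingale measure, there exists a
unique equivalent martingale measure minimizing the reverse relative entropy `H(P|·)`. -/
theorem exists_unique_min_reverse_entropy_mm
    {Ω : Type*} [Fintype Ω] [MeasurableSpace Ω] [MeasurableSingletonClass Ω]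
    (P : Measure Ω) [IsProbabilityMeasure P] (hP : ∀ ω, 0 < P {ω})
    (T d : ℕ) (F : ℕ → MeasurableSpace Ω) (hFmono : Monotone F)
    (hF0 : F 0 = ⊥) (hFle : ∀ t, F t ≤ ‹MeasurableSpace Ω›)
    (S : ℕ → Ω → Fin d → ℝ)
    (hadapted : ∀ t ≤ T, Measurable[F t] (S t))
    (M : Set (Measure Ω))
    (hM : ∀ Q : Measure Ω, Q ∈ M ↔
      IsProbabilityMeasure Q ∧ P ≪ Q ∧ Q ≪ P ∧
        ∀ t, 1 ≤ t → t ≤ T → (Q[S t | F (t - 1)]) =ᵐ[Q] S (t - 1))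
    (hMne : M.Nonempty) :
    ∃! Qhat : Measure Ω, Qhat ∈ M ∧ ∀ Q ∈ M, relEntropy P Qhat ≤ relEntropy P Q := by
  have hPr : ∀ ω, 0 < P.real {ω} := fun ω =>
    ENNReal.toReal_pos (hP ω).ne' (measure_ne_top _ _)
  set K : Set (Ω → ℝ) := stdSimplex ℝ Ω ∩ {q | ∀ t, 1 ≤ t → t ≤ T →
    ∀ A, MeasurableSet[F (t - 1)] A →
      ∑ ω, q ω • A.indicator (S (t - 1)) ω = ∑ ω, q ω • A.indicator (S t) ω} with hK
  have hKc : IsCompact K := by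
    refine (isCompact_stdSimplex ℝ Ω).inter_right ?_
    simp only [Set.ofPred_forall]
    refine isClosed_iInter fun t => isClosed_iInter fun _ => isClosed_iInter fun _ =>
      isClosed_iInter fun A => isClosed_iInter fun _ => isClosed_eq ?_ ?_ <;> fun_prop
  have hKconv : Convex ℝ K := by
    refine (convex_stdSimplex ℝ Ω).inter fun x hx y hy a b _ _ _ t h1 hT A hA => ?_
    simp only [Pi.add_apply, Pi.smul_apply, smul_eq_mul, add_smul, mul_smul,
      Finset.sum_add_distrib, ← Finset.smul_sum, hx t h1 hT A hA, hy t h1 hT A hA]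
  have hMK : ∀ Q : Measure Ω, Q ∈ M ↔ IsProbabilityMeasure Q ∧
      (fun ω => Q.real {ω}) ∈ K ∧ ∀ ω, 0 < Q.real {ω} := by
    intro Q
    rw [hM]
    refine and_congr_right fun hQ => ?_
    have hmart : (∀ t, 1 ≤ t → t ≤ T → (Q[S t | F (t - 1)]) =ᵐ[Q] S (t - 1)) ↔
        (fun ω => Q.real {ω}) ∈ K := by
      have hs : (fun ω => Q.real {ω}) ∈ stdSimplex ℝ Ω :=
        ⟨fun _ => measureReal_nonneg, by simp⟩
      rw [hK, Set.mem_inter_iff, and_iff_right hs]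
      exact forall_congr' fun t => forall_congr' fun _ => forall_congr' fun hT =>
        condExp_ae_eq_iff_forall_sum (hFle _) Q _ _
          (hadapted (t - 1) (by omega)).stronglyMeasurable
    constructor
    · rintro ⟨hPQ, -, h⟩
      exact ⟨hmart.1 h, fun ω => ENNReal.toReal_pos
        (fun h0 => (hP ω).ne' (hPQ h0)) (measure_ne_top _ _)⟩
    · rintro ⟨h, hpos⟩
      have hac : ∀ {μ ν : Measure Ω}, (∀ ω, 0 < μ.real {ω}) → ν ≪ μ := by
        intro μ ν hμ A hA
        have : A = ∅ := Set.eq_empty_of_forall_notMem fun ω hω => (hμ ω).ne' <| by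
          simp [Measure.real, measure_mono_null (Set.singleton_subset_iff.2 hω) hA]
        simp [this]
      exact ⟨hac hpos, hac hPr, hmart.2 h⟩
  have hle : ∀ Q ∈ M, ∀ R ∈ M, relEntropy P Q ≤ relEntropy P R ↔
      ∑ ω, P.real {ω} * Real.log (R.real {ω}) ≤ ∑ ω, P.real {ω} * Real.log (Q.real {ω}) :=
    fun Q hQ R hR => by
      rw [relEntropy_eq_sub hPr ((hMK Q).1 hQ).2.2, relEntropy_eq_sub hPr ((hMK R).1 hR).2.2,
        _root_.sub_le_sub_iff_left]
  have hlift : ∀ q ∈ K, (∀ ω, 0 < q ω) → ∃ Q ∈ M, (fun ω => Q.real {ω}) = q := by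
    intro q hq hpos
    obtain ⟨Q, hQ, hQq⟩ := exists_isProbabilityMeasure_real_singleton hq.1
    obtain rfl : (fun ω => Q.real {ω}) = q := funext hQq
    exact ⟨Q, (hMK Q).2 ⟨hQ, hq, hpos⟩, rfl⟩
  obtain ⟨Q₀, hQ₀⟩ := hMne
  obtain ⟨q, ⟨⟨hqK, hq0⟩, hqmax⟩, huniq⟩ := existsUnique_isMax_sum_mul_log hKc hKconv
    Set.inter_subset_left hPr ⟨_, ((hMK Q₀).1 hQ₀).2⟩
  obtain ⟨Q, hQM, rfl⟩ := hlift q hqK hq0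
  refine ⟨Q, ⟨hQM, fun R hR => (hle Q hQM R hR).2 ?_⟩, ?_⟩
  · exact hqmax _ ((hMK R).1 hR).2.1 ((hMK R).1 hR).2.2
  · rintro R ⟨hR, hRmin⟩
    have := ((hMK R).1 hR).1
    have := ((hMK Q).1 hQM).1
    refine measure_eq_of_real_singleton (congrFun (huniq _ ⟨((hMK R).1 hR).2, ?_⟩))
    intro r hr hr0
    obtain ⟨R', hR', rfl⟩ := hlift r hr hr0
    exact (hle R hR R' hR').1 (hRmin R' hR')
end

section
/- Consider a sequence of finite-market models as in the context, and assume M^n ≠ ∅ for every n. Let Q̂^n ∈ M^n be the (unique) minimal reverse entropy martingale measure, i.e. H(P_n|Q̂^n) ≤ H(P_n|Q) for all Q ∈ M^n. Then NAA holds if and only if (P_n) ◁ (Q̂^n), and SAA holds if and only if (P_n) △ (Q̂^n). -/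
open MeasureTheory Filter Topology ENNReal

/-- The discrete-time value process generated by initial capital `x` and the predictable
integrand `γ` against the price process `S`:
`X_t = x + ∑_{j=1}^t ⟨γ_j, S_j − S_{j−1}⟩`. -/
def wealth {Ω : Type*} {d : ℕ} (S : ℕ → Ω → Fin d → ℝ)
    (x : ℝ) (γ : ℕ → Ω → Fin d → ℝ) (t : ℕ) (ω : Ω) : ℝ :=
  x + ∑ j ∈ Finset.Icc 1 t, ∑ i, γ j ω i * (S j ω i - S (j - 1) ω i)

/-- Admissibility of `(x, γ)` on the horizon `T`: `γ` is predictable w.r.t. the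
filtration `F` and the generated value process is nonnegative up to time `T`. -/
def Adm {Ω : Type*} {d : ℕ} (F : ℕ → MeasurableSpace Ω) (S : ℕ → Ω → Fin d → ℝ)
    (T : ℕ) (x : ℝ) (γ : ℕ → Ω → Fin d → ℝ) : Prop :=
  (∀ j, 1 ≤ j → j ≤ T → Measurable[F (j - 1)] (γ j)) ∧
    ∀ t ≤ T, ∀ ω, 0 ≤ wealth S x γ t ω

/-- The weights `q` integrate every one-period gain on the horizon `T` to zero. -/
def IsMartingaleWeight {Ω : Type*} [Fintype Ω] {d : ℕ} (F : ℕ → MeasurableSpace Ω)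
    (S : ℕ → Ω → Fin d → ℝ) (T : ℕ) (q : Ω → ℝ) : Prop :=
  ∀ t, 1 ≤ t → t ≤ T → ∀ γ : Ω → Fin d → ℝ, Measurable[F (t - 1)] γ →
    ∑ ω, q ω * ∑ i, γ ω i * (S t ω i - S (t - 1) ω i) = 0

section Wealth

variable {Ω : Type*} {d : ℕ} {F : ℕ → MeasurableSpace Ω} {S : ℕ → Ω → Fin d → ℝ} {T : ℕ}

theorem wealth_zero (x : ℝ) (γ : ℕ → Ω → Fin d → ℝ) (ω : Ω) : wealth S x γ 0 ω = x := by
  simp [wealth]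

theorem wealth_succ (x : ℝ) (γ : ℕ → Ω → Fin d → ℝ) (t : ℕ) (ω : Ω) :
    wealth S x γ (t + 1) ω =
      wealth S x γ t ω + ∑ i, γ (t + 1) ω i * (S (t + 1) ω i - S t ω i) := by
  simp [wealth, Finset.sum_Icc_succ_top, add_assoc]

theorem wealth_add (x y : ℝ) (γ δ : ℕ → Ω → Fin d → ℝ) (t : ℕ) (ω : Ω) :
    wealth S (x + y) (γ + δ) t ω = wealth S x γ t ω + wealth S y δ t ω := by
  simp only [wealth, Pi.add_apply, add_mul, Finset.sum_add_distrib]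
  ring

theorem wealth_smul (c x : ℝ) (γ : ℕ → Ω → Fin d → ℝ) (t : ℕ) (ω : Ω) :
    wealth S (c * x) (c • γ) t ω = c * wealth S x γ t ω := by
  simp only [wealth, Pi.smul_apply, smul_eq_mul, mul_assoc, ← Finset.mul_sum, mul_add]

theorem measurable_wealth (hF : Monotone F) (hS : ∀ t ≤ T, Measurable[F t] (S t)) {x : ℝ}
    {γ : ℕ → Ω → Fin d → ℝ} (hγ : ∀ j, 1 ≤ j → j ≤ T → Measurable[F (j - 1)] (γ j))
    {t : ℕ} (ht : t ≤ T) : Measurable[F t] (wealth S x γ t) := by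
  unfold wealth
  refine Measurable.add (by fun_prop) (Finset.measurable_fun_sum _ fun j hj => ?_)
  obtain ⟨h1, h2⟩ := Finset.mem_Icc.mp hj
  have hγj : Measurable[F t] (γ j) := (hγ j h1 (h2.trans ht)).mono (hF (by omega)) le_rfl
  have hSj : Measurable[F t] (S j) := (hS j (h2.trans ht)).mono (hF h2) le_rfl
  have hSj' : Measurable[F t] (S (j - 1)) :=
    (hS (j - 1) (by omega)).mono (hF (by omega)) le_rfl
  refine Finset.measurable_fun_sum _ fun i _ => ?_
  exact ((measurable_pi_apply i).comp hγj).mul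
    (((measurable_pi_apply i).comp hSj).sub ((measurable_pi_apply i).comp hSj'))

theorem Adm.smul {x : ℝ} {γ : ℕ → Ω → Fin d → ℝ} (h : Adm F S T x γ) {c : ℝ} (hc : 0 ≤ c) :
    Adm F S T (c * x) (c • γ) := by
  refine ⟨fun j h1 h2 => (h.1 j h1 h2).const_smul c, fun t ht ω => ?_⟩
  rw [wealth_smul]
  exact mul_nonneg hc (h.2 t ht ω)

/-- Terminal values of the self-financing strategies with predictable integrand. -/
def attainable (F : ℕ → MeasurableSpace Ω) (S : ℕ → Ω → Fin d → ℝ) (T : ℕ) :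
    Submodule ℝ (Ω → ℝ) where
  carrier := {f | ∃ (x : ℝ) (γ : ℕ → Ω → Fin d → ℝ),
    (∀ j, 1 ≤ j → j ≤ T → Measurable[F (j - 1)] (γ j)) ∧ f = wealth S x γ T}
  zero_mem' := ⟨0, 0, fun _ _ _ => measurable_const, by ext ω; simp [wealth]⟩
  add_mem' := by
    rintro _ _ ⟨x, γ, hγ, rfl⟩ ⟨y, δ, hδ, rfl⟩
    exact ⟨x + y, γ + δ, fun j h1 h2 => (hγ j h1 h2).add (hδ j h1 h2),
      by ext ω; simp [wealth_add]⟩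
  smul_mem' := by
    rintro c _ ⟨x, γ, hγ, rfl⟩
    exact ⟨c * x, c • γ, fun j h1 h2 => (hγ j h1 h2).const_smul c,
      by ext ω; simp [wealth_smul]⟩

theorem one_mem_attainable : (1 : Ω → ℝ) ∈ attainable F S T :=
  ⟨1, 0, fun _ _ _ => measurable_const, by ext ω; simp [wealth]⟩

theorem gain_mem_attainable {t : ℕ} (h1 : 1 ≤ t) (hT : t ≤ T) {γ : Ω → Fin d → ℝ}
    (hγ : Measurable[F (t - 1)] γ) :
    (fun ω => ∑ i, γ ω i * (S t ω i - S (t - 1) ω i)) ∈ attainable F S T := by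
  refine ⟨0, fun j => if j = t then γ else 0, fun j _ _ => ?_, ?_⟩
  · by_cases h : j = t
    · subst h; simpa using hγ
    · simp only [h, if_false]
      exact measurable_const
  · ext ω
    rw [wealth, Finset.sum_eq_single t]
    · simp
    · intro j _ hj; simp [hj]
    · intro h; exact absurd (Finset.mem_Icc.mpr ⟨h1, hT⟩) h

end Wealth

section Weights

variable {Ω : Type*} [Fintype Ω] {d : ℕ} {F : ℕ → MeasurableSpace Ω}
  {S : ℕ → Ω → Fin d → ℝ} {T : ℕ}

theorem IsMartingaleWeight.sum_indicator_wealth {q : Ω → ℝ} (hq : IsMartingaleWeight F S T q)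
    (hF : Monotone F) {x : ℝ} {γ : ℕ → Ω → Fin d → ℝ}
    (hγ : ∀ j, 1 ≤ j → j ≤ T → Measurable[F (j - 1)] (γ j)) {t : ℕ} {A : Set Ω}
    (hA : MeasurableSet[F t] A) {s : ℕ} (hts : t ≤ s) (hsT : s ≤ T) :
    ∑ ω, q ω * A.indicator (wealth S x γ s) ω = ∑ ω, q ω * A.indicator (wealth S x γ t) ω := by
  classical
  induction s, hts using Nat.le_induction with
  | base => rfl
  | succ s hts ih =>
    rw [← ih (by omega)]
    have h := hq (s + 1) (by omega) hsT (A.indicator (γ (s + 1)))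
      ((hγ (s + 1) (by omega) hsT).indicator (hF (by simpa using hts) A hA))
    rw [← sub_eq_zero, ← Finset.sum_sub_distrib, ← h]
    refine Finset.sum_congr rfl fun ω _ => ?_
    by_cases hω : ω ∈ A <;> simp [hω, wealth_succ, mul_add]

theorem IsMartingaleWeight.sum_wealth {q : Ω → ℝ} (hq : IsMartingaleWeight F S T q)
    (hF : Monotone F) (hq1 : ∑ ω, q ω = 1) {x : ℝ} {γ : ℕ → Ω → Fin d → ℝ}
    (hγ : ∀ j, 1 ≤ j → j ≤ T → Measurable[F (j - 1)] (γ j)) :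
    ∑ ω, q ω * wealth S x γ T ω = x := by
  have h := hq.sum_indicator_wealth hF (x := x) hγ (t := 0) (A := Set.univ)
    MeasurableSet.univ (Nat.zero_le T) le_rfl
  simpa [wealth_zero, ← Finset.sum_mul, hq1] using h

theorem adm_of_terminal_nonneg {q : Ω → ℝ} (hq : IsMartingaleWeight F S T q)
    (hqpos : ∀ ω, 0 < q ω) (hF : Monotone F) (hS : ∀ t ≤ T, Measurable[F t] (S t)) {x : ℝ}
    {γ : ℕ → Ω → Fin d → ℝ} (hγ : ∀ j, 1 ≤ j → j ≤ T → Measurable[F (j - 1)] (γ j))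
    (hpos : ∀ ω, 0 ≤ wealth S x γ T ω) : Adm F S T x γ := by
  refine ⟨hγ, fun t ht ω₀ => ?_⟩
  by_contra! hneg
  set A : Set Ω := {ω | wealth S x γ t ω < 0} with hA
  have hAm : MeasurableSet[F t] A := by
    have := measurable_wealth (x := x) hF hS hγ ht
    exact this measurableSet_Iio
  have h := hq.sum_indicator_wealth (x := x) hF hγ hAm ht le_rfl
  have h1 : 0 ≤ ∑ ω, q ω * A.indicator (wealth S x γ T) ω :=
    Finset.sum_nonneg fun ω _ =>
      mul_nonneg (hqpos ω).le (Set.indicator_nonneg (fun ω _ => hpos ω) ω)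
  have h2 : ∑ ω, q ω * A.indicator (wealth S x γ t) ω < 0 := by
    refine Finset.sum_neg' (fun ω _ => ?_) ⟨ω₀, Finset.mem_univ _, ?_⟩
    · exact mul_nonpos_of_nonneg_of_nonpos (hqpos ω).le
        (Set.indicator_nonpos (fun ω hω => le_of_lt hω) ω)
    · have : ω₀ ∈ A := hneg
      rw [Set.indicator_of_mem this]
      exact mul_neg_of_pos_of_neg (hqpos ω₀) hneg
  linarith

/-- First-order condition for the minimal reverse entropy weights: the density `p / q` is
attainable. -/
theorem div_mem_attainable_of_minimal {p q : Ω → ℝ} (hp : ∀ ω, 0 < p ω) (hq : ∀ ω, 0 < q ω)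
    (hq1 : ∑ ω, q ω = 1) (hqm : IsMartingaleWeight F S T q)
    (hmin : ∀ w : Ω → ℝ, (∀ ω, 0 < w ω) → ∑ ω, w ω = 1 → IsMartingaleWeight F S T w →
      ∑ ω, p ω * Real.log (p ω / q ω) ≤ ∑ ω, p ω * Real.log (p ω / w ω)) :
    (fun ω => p ω / q ω) ∈ attainable F S T := by
  classical
  by_contra hnot
  obtain ⟨φ, hφ, hker⟩ := Submodule.exists_le_ker_of_notMem hnot
  set h : Ω → ℝ := fun ω => φ (Pi.single ω 1) with hh
  have hφf : ∀ f : Ω → ℝ, φ f = ∑ ω, h ω * f ω := by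
    intro f
    conv_lhs => rw [pi_eq_sum_univ' f]
    simp [hh, mul_comm, Pi.single]
  have hzero : ∀ f ∈ attainable F S T, ∑ ω, h ω * f ω = 0 := fun f hf => by
    rw [← hφf]; exact hker hf
  have hderiv : HasDerivAt (fun ε : ℝ => ∑ ω, p ω * Real.log (p ω / (q ω + ε * h ω)))
      (∑ ω, -(h ω * (p ω / q ω))) 0 := by
    refine HasDerivAt.fun_sum fun ω _ => ?_
    have hne : q ω + 0 * h ω ≠ 0 := by simpa using (hq ω).ne'
    have h1 : HasDerivAt (fun ε : ℝ => q ω + ε * h ω) (h ω) 0 := by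
      simpa using ((hasDerivAt_id (0 : ℝ)).mul_const (h ω)).const_add (q ω)
    have h2 := ((h1.fun_inv hne).const_mul (p ω)).log
      (mul_ne_zero (hp ω).ne' (inv_ne_zero hne))
    simp only [← div_eq_mul_inv] at h2
    refine (h2.const_mul (p ω)).congr_deriv ?_
    have := (hq ω).ne'
    have := (hp ω).ne'
    simp only [zero_mul, add_zero]
    field_simp
  have hlocal : IsLocalMin (fun ε : ℝ => ∑ ω, p ω * Real.log (p ω / (q ω + ε * h ω))) 0 := by
    have hev : ∀ᶠ ε : ℝ in 𝓝 0, ∀ ω, 0 < q ω + ε * h ω := by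
      refine eventually_all.2 fun ω => ?_
      have hc : ContinuousAt (fun ε : ℝ => q ω + ε * h ω) 0 := by fun_prop
      exact hc.eventually (lt_mem_nhds (by simpa using hq ω))
    filter_upwards [hev] with ε hε
    have hsum : ∑ ω, h ω = 0 := by simpa using hzero 1 one_mem_attainable
    have := hmin _ hε (by simp [Finset.sum_add_distrib, ← Finset.mul_sum, hsum, hq1]) ?_
    · simpa using this
    · intro t h1 hT γ hγ
      have ha := hzero _ (gain_mem_attainable (S := S) h1 hT hγ)
      have hb := hqm t h1 hT γ hγ
      simp only [add_mul, Finset.sum_add_distrib, mul_assoc, ← Finset.mul_sum, ha, hb]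
      simp
  have h0 := hlocal.hasDerivAt_eq_zero hderiv
  rw [Finset.sum_neg_distrib, neg_eq_zero] at h0
  exact hφ ((hφf _).trans h0)

theorem exists_adm_terminal_eq_div {p q : Ω → ℝ} (hp : ∀ ω, 0 < p ω) (hq : ∀ ω, 0 < q ω)
    (hp1 : ∑ ω, p ω = 1) (hq1 : ∑ ω, q ω = 1) (hqm : IsMartingaleWeight F S T q)
    (hF : Monotone F) (hS : ∀ t ≤ T, Measurable[F t] (S t))
    (hmin : ∀ w : Ω → ℝ, (∀ ω, 0 < w ω) → ∑ ω, w ω = 1 → IsMartingaleWeight F S T w →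
      ∑ ω, p ω * Real.log (p ω / q ω) ≤ ∑ ω, p ω * Real.log (p ω / w ω)) :
    ∃ γ : ℕ → Ω → Fin d → ℝ, Adm F S T 1 γ ∧ ∀ ω, wealth S 1 γ T ω = p ω / q ω := by
  obtain ⟨x, γ, hγ, hf⟩ := div_mem_attainable_of_minimal hp hq hq1 hqm hmin
  have hx : x = 1 := by
    rw [← hqm.sum_wealth (x := x) hF hq1 hγ, ← hf, ← hp1]
    exact Finset.sum_congr rfl fun ω _ => mul_div_cancel₀ _ (hq ω).ne'
  subst hx
  refine ⟨γ, adm_of_terminal_nonneg hqm hq hF hS hγ fun ω => ?_, fun ω => (congrFun hf ω).symm⟩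
  rw [← hf]
  exact (div_pos (hp ω) (hq ω)).le

end Weights

section FiniteMeasure

theorem absolutelyContinuous_of_singleton_pos {Ω : Type*} [MeasurableSpace Ω] {P Q : Measure Ω} (hQ : ∀ ω, 0 < Q {ω}) :
    P ≪ Q := by
  intro s hs
  have : s = ∅ := by
    refine Set.eq_empty_of_forall_notMem fun ω hω => ?_
    exact (hQ ω).ne' (measure_mono_null (Set.singleton_subset_iff.mpr hω) hs)
  simp [this]

variable {Ω : Type*} [Fintype Ω] [MeasurableSpace Ω] [DiscreteMeasurableSpace Ω]

theorem sum_measureReal_singleton_univ (Q : Measure Ω) [IsProbabilityMeasure Q] :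
    ∑ ω, Q.real {ω} = 1 := by
  simp

theorem exists_measure_of_weights {w : Ω → ℝ} (hw : ∀ ω, 0 < w ω) (hw1 : ∑ ω, w ω = 1) :
    ∃ Q : Measure Ω, IsProbabilityMeasure Q ∧ (∀ ω, 0 < Q {ω}) ∧ ∀ ω, Q.real {ω} = w ω := by
  classical
  have hQ : ∀ ω, (∑ η, ENNReal.ofReal (w η) • Measure.dirac η : Measure Ω) {ω} =
      ENNReal.ofReal (w ω) := by
    intro ω
    simp [Measure.finsetSum_apply, Set.indicator_apply]
  refine ⟨∑ η, ENNReal.ofReal (w η) • Measure.dirac η, ⟨?_⟩, fun ω => ?_, fun ω => ?_⟩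
  · simp [Measure.finsetSum_apply, ← ENNReal.ofReal_sum_of_nonneg fun ω _ => (hw ω).le, hw1]
  · simpa [hQ] using hw ω
  · simp [Measure.real, hQ, (hw ω).le]

theorem setIntegral_eq_sum_indicator {E : Type*} [NormedAddCommGroup E] [NormedSpace ℝ E]
    [CompleteSpace E] (Q : Measure Ω) [IsFiniteMeasure Q] (f : Ω → E) (A : Set Ω) :
    ∫ ω in A, f ω ∂Q = ∑ ω, Q.real {ω} • A.indicator f ω := by
  rw [← integral_indicator (MeasurableSet.of_discrete), integral_fintype .of_finite]

theorem condExp_ae_eq_iff {Ω : Type*} [Fintype Ω] {d : ℕ} {m mΩ : MeasurableSpace Ω}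
    [DiscreteMeasurableSpace Ω] (hm : m ≤ mΩ) (Q : Measure Ω) [IsProbabilityMeasure Q]
    {f g : Ω → Fin d → ℝ} (hg : Measurable[m] g) :
    Q[f | m] =ᵐ[Q] g ↔ ∀ γ : Ω → Fin d → ℝ, Measurable[m] γ →
      ∑ ω, Q.real {ω} * ∑ i, γ ω i * (f ω i - g ω i) = 0 := by
  classical
  constructor
  · intro h γ hγ
    have hset : ∀ A, MeasurableSet[m] A → ∀ i,
        ∑ ω, Q.real {ω} * A.indicator (fun ω => f ω i - g ω i) ω = 0 := by
      intro A hA i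
      have h1 : ∫ ω in A, g ω ∂Q = ∫ ω in A, f ω ∂Q := by
        rw [← setIntegral_condExp hm (.of_finite : Integrable f Q) hA]
        exact integral_congr_ae (ae_restrict_of_ae (h.mono fun _ h => h.symm))
      rw [setIntegral_eq_sum_indicator, setIntegral_eq_sum_indicator] at h1
      have h2 := congrFun h1 i
      simp only [Finset.sum_apply, Pi.smul_apply, smul_eq_mul] at h2
      rw [← sub_eq_zero, ← Finset.sum_sub_distrib] at h2
      rw [← neg_eq_zero, ← h2, ← Finset.sum_neg_distrib]
      refine Finset.sum_congr rfl fun ω _ => ?_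
      by_cases hω : ω ∈ A
      · simp [hω]; ring
      · simp [hω]
    have hi : ∀ i, ∑ ω, Q.real {ω} * (γ ω i * (f ω i - g ω i)) = 0 := by
      intro i
      rw [← Finset.sum_fiberwise_of_maps_to (t := Finset.univ.image fun ω => γ ω i)
        (g := fun ω => γ ω i) (fun ω _ => Finset.mem_image_of_mem _ (Finset.mem_univ ω))]
      refine Finset.sum_eq_zero fun v _ => ?_
      have hv : MeasurableSet[m] {ω | γ ω i = v} :=
        ((measurable_pi_apply i).comp hγ) (measurableSet_singleton v)
      have h3 := congrArg (v * ·) (hset _ hv i)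
      simp only [mul_zero, Finset.mul_sum] at h3
      rw [← h3, Finset.sum_filter]
      refine Finset.sum_congr rfl fun ω _ => ?_
      by_cases hω : γ ω i = v
      · simp [hω]; ring
      · simp [hω]
    simp only [Finset.mul_sum]
    rw [Finset.sum_comm]
    exact Finset.sum_eq_zero fun i _ => hi i
  · intro h
    refine (ae_eq_condExp_of_forall_setIntegral_eq hm .of_finite
      (fun _ _ _ => Integrable.integrableOn .of_finite) (fun A hA _ => ?_)
      hg.stronglyMeasurable.aestronglyMeasurable).symm
    rw [setIntegral_eq_sum_indicator, setIntegral_eq_sum_indicator]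
    ext i
    have hγ : Measurable[m] (A.indicator fun _ : Ω => (Pi.single i 1 : Fin d → ℝ)) :=
      measurable_const.indicator hA
    have h1 := h _ hγ
    simp only [Finset.sum_apply, Pi.smul_apply, smul_eq_mul]
    rw [← sub_eq_zero, ← Finset.sum_sub_distrib, ← neg_eq_zero, ← h1, ← Finset.sum_neg_distrib]
    refine Finset.sum_congr rfl fun ω _ => ?_
    by_cases hω : ω ∈ A
    · simp [hω, Pi.single_apply]; ring
    · simp [hω]

theorem isMartingaleWeight_iff_condExp {d T : ℕ} {F : ℕ → MeasurableSpace Ω}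
    {S : ℕ → Ω → Fin d → ℝ} (hFle : ∀ t, F t ≤ (inferInstance : MeasurableSpace Ω))
    (hS : ∀ t ≤ T, Measurable[F t] (S t)) (Q : Measure Ω) [IsProbabilityMeasure Q] :
    IsMartingaleWeight F S T (fun ω => Q.real {ω}) ↔
      ∀ t, 1 ≤ t → t ≤ T → Q[S t | F (t - 1)] =ᵐ[Q] S (t - 1) :=
  forall₃_congr fun t _ hT => (condExp_ae_eq_iff (hFle _) Q (hS (t - 1) (by omega))).symm

theorem measure_one_le_wealth_le {d T : ℕ} {F : ℕ → MeasurableSpace Ω}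
    {S : ℕ → Ω → Fin d → ℝ} (hF : Monotone F) (Q : Measure Ω) [IsProbabilityMeasure Q]
    (hQ : IsMartingaleWeight F S T (fun ω => Q.real {ω})) {x : ℝ} {γ : ℕ → Ω → Fin d → ℝ}
    (h : Adm F S T x γ) : Q {ω | 1 ≤ wealth S x γ T ω} ≤ ENNReal.ofReal x := by
  rw [← ENNReal.ofReal_toReal (measure_ne_top Q {ω | 1 ≤ wealth S x γ T ω})]
  refine ENNReal.ofReal_le_ofReal ?_
  have hx := hQ.sum_wealth hF (sum_measureReal_singleton_univ Q) (x := x) h.1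
  have hmarkov := mul_meas_ge_le_integral_of_nonneg (μ := Q) (f := wealth S x γ T)
    (.of_forall fun ω => h.2 T le_rfl ω) .of_finite 1
  rw [integral_fintype .of_finite] at hmarkov
  simp only [smul_eq_mul, hx, one_mul] at hmarkov
  exact hmarkov

/-- Where the density `dP/dQ` is below `1 / c` the measure `P` is at most `Q / c`. -/
theorem measure_le_div_add_density (P Q : Measure Ω) [IsProbabilityMeasure P]
    [IsProbabilityMeasure Q] (hQ : ∀ ω, 0 < Q {ω}) {c : ℝ} (hc : 0 < c) (A : Set Ω) :
    P.real A ≤ Q.real A / c + P.real {ω | 1 ≤ c * (P.real {ω} / Q.real {ω})} := by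
  classical
  have hsum : ∀ (R : Measure Ω) [IsProbabilityMeasure R] (B : Set Ω),
      R.real B = ∑ ω, R.real {ω} * B.indicator 1 ω := by
    intro R _ B
    have := setIntegral_eq_sum_indicator R (fun _ => (1 : ℝ)) B
    simpa [Pi.one_def] using this
  rw [hsum P A, hsum Q A, hsum P, Finset.sum_div, ← Finset.sum_add_distrib]
  refine Finset.sum_le_sum fun ω _ => ?_
  have hq : 0 < Q.real {ω} := ENNReal.toReal_pos (hQ ω).ne' (measure_ne_top _ _)
  have hp : 0 ≤ P.real {ω} := measureReal_nonneg
  have hqc : 0 ≤ Q.real {ω} / c := (div_pos hq hc).le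
  by_cases hA : ω ∈ A <;> by_cases hB : 1 ≤ c * (P.real {ω} / Q.real {ω}) <;>
    simp only [Set.indicator, Set.mem_ofPred_eq, hA, hB, if_true, if_false, Pi.one_apply, mul_one,
      mul_zero, add_zero, zero_div, zero_add, le_add_iff_nonneg_left, hqc, hp, le_refl]
  rw [not_le, ← mul_div_assoc, div_lt_one hq] at hB
  rw [le_div_iff₀ hc]
  linarith

end FiniteMeasure

theorem exists_strictMono_tendsto_limsup (u : ℕ → ℝ≥0∞) :
    ∃ φ : ℕ → ℕ, StrictMono φ ∧ Tendsto (u ∘ φ) atTop (𝓝 (limsup u atTop)) := by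
  obtain ⟨v, huv, hv⟩ := exists_seq_tendsto_limsup (f := atTop) (u := u)
  obtain ⟨ψ, hψ, hvψ⟩ := strictMono_subseq_of_tendsto_atTop hv
  exact ⟨v ∘ ψ, hvψ, huv.comp hψ.tendsto_atTop⟩

/-- A family of sets given along an injective sequence of indices extends by `∅`. -/
theorem exists_set_extension {Ω : ℕ → Type*} {φ : ℕ → ℕ} (hφ : φ.Injective)
    (A : ∀ k, Set (Ω (φ k))) :
    ∃ B : ∀ n, Set (Ω n), (∀ k, B (φ k) = A k) ∧ ∀ n ∉ Set.range φ, B n = ∅ := by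
  classical
  refine ⟨fun n => if h : ∃ k, φ k = n then h.choose_spec ▸ A h.choose else ∅,
    fun k => ?_, fun n hn => dif_neg hn⟩
  have h : ∃ j, φ j = φ k := ⟨k, rfl⟩
  beta_reduce
  rw [dif_pos h]
  have key : ∀ j (hj : φ j = φ k), (hj ▸ A j : Set (Ω (φ k))) = A k := by
    intro j hj
    obtain rfl := hφ hj
    rfl
  exact key _ h.choose_spec

/-- Theorem 5: for a sequence of finite-market models, each admitting equivalent
martingale measures, with `Q̂ⁿ` the minimal reverse entropy martingale measures,
NAA holds iff `(Pₙ) ◁ (Q̂ⁿ)` and SAA holds iff `(Pₙ) △ (Q̂ⁿ)`. -/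
theorem naa_saa_iff_min_reverse_entropy
    (Ω : ℕ → Type*) [∀ n, Fintype (Ω n)] [∀ n, MeasurableSpace (Ω n)]
    (hfull : ∀ n, (inferInstance : MeasurableSpace (Ω n)) = ⊤)
    (P : ∀ n, Measure (Ω n)) (hP : ∀ n, IsProbabilityMeasure (P n))
    (hPpos : ∀ n, ∀ ω : Ω n, 0 < P n {ω})
    (T d : ℕ → ℕ)
    (F : ∀ n, ℕ → MeasurableSpace (Ω n)) (hFmono : ∀ n, Monotone (F n))
    (hF0 : ∀ n, F n 0 = ⊥) (hFT : ∀ n, F n (T n) = ⊤)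
    (hFle : ∀ n t, F n t ≤ (inferInstance : MeasurableSpace (Ω n)))
    (S : ∀ n, ℕ → Ω n → Fin (d n) → ℝ)
    (hadapted : ∀ n, ∀ t ≤ T n, Measurable[F n t] (S n t))
    (M : ∀ n, Set (Measure (Ω n)))
    (hM : ∀ n, ∀ Q : Measure (Ω n), Q ∈ M n ↔
      IsProbabilityMeasure Q ∧ P n ≪ Q ∧ Q ≪ P n ∧
        ∀ t, 1 ≤ t → t ≤ T n → (Q[S n t | F n (t - 1)]) =ᵐ[Q] S n (t - 1))
    (hMne : ∀ n, (M n).Nonempty)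
    (Qhat : ∀ n, Measure (Ω n))
    (hQhatM : ∀ n, Qhat n ∈ M n)
    (hQhatmin : ∀ n, ∀ Q ∈ M n, relEntropy (P n) (Qhat n) ≤ relEntropy (P n) Q) :
    ((∀ (x : ℕ → ℝ) (γ : ∀ n, ℕ → Ω n → Fin (d n) → ℝ),
        (∀ n, Adm (F n) (S n) (T n) (x n) (γ n)) →
        Tendsto x atTop (𝓝 (0 : ℝ)) →
        limsup (fun n => P n {ω | 1 ≤ wealth (S n) (x n) (γ n) (T n) ω}) atTop = 0)
      ↔ Contig P Qhat) ∧
    ((∃ (x : ℕ → ℝ) (γ : ∀ n, ℕ → Ω n → Fin (d n) → ℝ),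
        (∀ n, Adm (F n) (S n) (T n) (x n) (γ n)) ∧
        Tendsto x atTop (𝓝 (0 : ℝ)) ∧
        limsup (fun n => P n {ω | 1 ≤ wealth (S n) (x n) (γ n) (T n) ω}) atTop = 1)
      ↔ EntSep P Qhat) := by
  have hdisc : ∀ n, DiscreteMeasurableSpace (Ω n) := fun n => by
    refine ⟨fun s => ?_⟩
    have h : ‹∀ n, MeasurableSpace (Ω n)› n = ⊤ := hfull n
    rw [h]
    trivial
  have hQ : ∀ n, IsProbabilityMeasure (Qhat n) := fun n => ((hM n _).1 (hQhatM n)).1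
  have hQpos : ∀ n ω, 0 < Qhat n {ω} := fun n ω => by
    refine pos_iff_ne_zero.2 fun h => (hPpos n ω).ne' (((hM n _).1 (hQhatM n)).2.1 h)
  have hQm : ∀ n, IsMartingaleWeight (F n) (S n) (T n) (fun ω => (Qhat n).real {ω}) := fun n =>
    (isMartingaleWeight_iff_condExp (hFle n) (hadapted n) _).2 ((hM n _).1 (hQhatM n)).2.2.2
  have hbound : ∀ (x : ℕ → ℝ) (γ : ∀ n, ℕ → Ω n → Fin (d n) → ℝ),
      (∀ n, Adm (F n) (S n) (T n) (x n) (γ n)) → Tendsto x atTop (𝓝 0) →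
      Tendsto (fun n => Qhat n {ω | 1 ≤ wealth (S n) (x n) (γ n) (T n) ω}) atTop (𝓝 0) := by
    intro x γ hadm hx
    have hx' : Tendsto (fun n => ENNReal.ofReal (x n)) atTop (𝓝 0) := by
      simpa using ENNReal.tendsto_ofReal hx
    exact tendsto_of_tendsto_of_tendsto_of_le_of_le tendsto_const_nhds hx'
      (fun _ => zero_le) fun n => measure_one_le_wealth_le (hFmono n) _ (hQm n) (hadm n)
  have hrep : ∀ n, ∃ γ : ℕ → Ω n → Fin (d n) → ℝ, Adm (F n) (S n) (T n) 1 γ ∧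
      ∀ ω, wealth (S n) 1 γ (T n) ω = (P n).real {ω} / (Qhat n).real {ω} := by
    intro n
    refine exists_adm_terminal_eq_div
      (fun ω => ENNReal.toReal_pos (hPpos n ω).ne' (measure_ne_top _ _))
      (fun ω => ENNReal.toReal_pos (hQpos n ω).ne' (measure_ne_top _ _))
      (sum_measureReal_singleton_univ _) (sum_measureReal_singleton_univ _) (hQm n) (hFmono n)
      (hadapted n) fun w hw hw1 hwm => ?_
    obtain ⟨Q, hQprob, hQp, hQw⟩ := exists_measure_of_weights hw hw1
    have hmem : Q ∈ M n := (hM n Q).2 ⟨hQprob, absolutelyContinuous_of_singleton_pos hQp,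
      absolutelyContinuous_of_singleton_pos (hPpos n),
      (isMartingaleWeight_iff_condExp (hFle n) (hadapted n) Q).1 (by simpa only [hQw] using hwm)⟩
    simpa only [relEntropy, ← measureReal_def, hQw] using hQhatmin n Q hmem
  choose γ₀ hγ₀ hγ₀T using hrep
  have hstrat : ∀ A : ∀ n, Set (Ω n), Tendsto (fun n => Qhat n (A n)) atTop (𝓝 0) →
      ∃ (x : ℕ → ℝ) (γ : ∀ n, ℕ → Ω n → Fin (d n) → ℝ),
        (∀ n, Adm (F n) (S n) (T n) (x n) (γ n)) ∧ Tendsto x atTop (𝓝 0) ∧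
        ∀ n, P n (A n) ≤
          ENNReal.ofReal (x n) + P n {ω | 1 ≤ wealth (S n) (x n) (γ n) (T n) ω} := by
    intro A hA
    have hA' : Tendsto (fun n => (Qhat n).real (A n)) atTop (𝓝 0) := by
      simpa [measureReal_def, Function.comp_def] using (ENNReal.tendsto_toReal ENNReal.zero_ne_top).comp hA
    set x : ℕ → ℝ := fun n => √((Qhat n).real (A n) + 1 / ((n : ℝ) + 1)) with hx
    have hsq : ∀ n : ℕ, 0 < (Qhat n).real (A n) + 1 / ((n : ℝ) + 1) := fun n =>
      add_pos_of_nonneg_of_pos measureReal_nonneg (by positivity)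
    have hxpos : ∀ n, 0 < x n := fun n => Real.sqrt_pos.2 (hsq n)
    refine ⟨x, fun n => x n • γ₀ n, fun n => ?_, ?_, fun n => ?_⟩
    · simpa using (hγ₀ n).smul (hxpos n).le
    · simpa [hx] using (hA'.add tendsto_one_div_add_atTop_nhds_zero_nat).sqrt
    · have hw : ∀ ω, wealth (S n) (x n) (x n • γ₀ n) (T n) ω =
          x n * ((P n).real {ω} / (Qhat n).real {ω}) := fun ω => by
        rw [← hγ₀T n ω, ← wealth_smul, mul_one]
      simp only [hw]
      have h := measure_le_div_add_density (P n) (Qhat n) (hQpos n) (hxpos n) (A n)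
      have hle : (Qhat n).real (A n) / x n ≤ x n := by
        rw [div_le_iff₀ (hxpos n), Real.mul_self_sqrt (hsq n).le]
        exact le_add_of_nonneg_right (by positivity)
      rw [← ofReal_measureReal, ← ofReal_measureReal (s := {ω | 1 ≤ _}),
        ← ENNReal.ofReal_add (hxpos n).le measureReal_nonneg]
      exact ENNReal.ofReal_le_ofReal (by linarith)
  refine ⟨⟨fun hNAA A _ hA => ?_, fun hcont x γ hadm hx => ?_⟩,
    ⟨fun ⟨x, γ, hadm, hx, hlim⟩ => ?_, fun ⟨φ, hφ, A, _, hPA, hQA⟩ => ?_⟩⟩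
  · obtain ⟨x, γ, hadm, hx, hle⟩ := hstrat A hA
    have hX : Tendsto (fun n => P n {ω | 1 ≤ wealth (S n) (x n) (γ n) (T n) ω}) atTop (𝓝 0) :=
      tendsto_of_le_liminf_of_limsup_le zero_le (hNAA x γ hadm hx).le
    have hsum := (ENNReal.tendsto_ofReal hx).add hX
    rw [ENNReal.ofReal_zero, add_zero] at hsum
    exact tendsto_of_tendsto_of_tendsto_of_le_of_le tendsto_const_nhds hsum
      (fun _ => zero_le) hle
  · exact (hcont _ (fun _ => .of_discrete) (hbound x γ hadm hx)).limsup_eq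
  · obtain ⟨φ, hφ, hφP⟩ := exists_strictMono_tendsto_limsup
      (fun n => P n {ω | 1 ≤ wealth (S n) (x n) (γ n) (T n) ω})
    rw [hlim] at hφP
    exact ⟨φ, hφ, fun k => {ω | 1 ≤ wealth (S (φ k)) (x (φ k)) (γ (φ k)) (T (φ k)) ω},
      fun _ => .of_discrete, hφP, (hbound x γ hadm hx).comp hφ.tendsto_atTop⟩
  · obtain ⟨B, hB, hB'⟩ := exists_set_extension hφ.injective A
    have hQB : Tendsto (fun n => Qhat n (B n)) atTop (𝓝 0) := by
      rw [ENNReal.tendsto_atTop_zero] at hQA ⊢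
      intro ε hε
      obtain ⟨k₀, hk₀⟩ := hQA ε hε
      refine ⟨φ k₀, fun n hn => ?_⟩
      by_cases hr : n ∈ Set.range φ
      · obtain ⟨k, rfl⟩ := hr
        rw [hB]
        exact hk₀ k (hφ.le_iff_le.1 hn)
      · simp [hB' n hr]
    obtain ⟨x, γ, hadm, hx, hle⟩ := hstrat B hQB
    refine ⟨x, γ, hadm, hx, le_antisymm ?_ ?_⟩
    · exact limsup_le_of_le (h := .of_forall fun n => prob_le_one)
    · have hx0 : Tendsto (fun k => ENNReal.ofReal (x (φ k))) atTop (𝓝 0) := by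
        simpa using ENNReal.tendsto_ofReal (hx.comp hφ.tendsto_atTop)
      have hdiff := ENNReal.Tendsto.sub hPA hx0 (.inl ENNReal.one_ne_top)
      rw [tsub_zero] at hdiff
      rw [← hdiff.limsup_eq]
      refine (limsup_le_limsup (.of_forall fun k => ?_)).trans
        (Tendsto.limsup_comp_le_limsup hφ.tendsto_atTop
          (u := fun n => P n {ω | 1 ≤ wealth (S n) (x n) (γ n) (T n) ω}))
      have := hle (φ k)
      rw [hB] at this
      exact tsub_le_iff_left.2 this
end

section
/- Let ξ be a random variable on a probability space (Ω, 𝓕, P) with ξ > 0 almost surely and E[1/ξ] ≤ 1, and let α ∈ (0,1), M > 0, N > 0. Then E[ξ^{-α}] ≤ (1/M)^α + (1/N)^{1-α} + N^α · P(ξ < M). -/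
open MeasureTheory ENNReal

/-- If `y ≥ N > 0` and `α ≤ 1`, then `y ^ α` is bounded by a multiple of `y`. -/
lemma Real.rpow_le_one_div_rpow_mul {α N y : ℝ} (hα : α ≤ 1) (hN : 0 < N) (hy : N ≤ y) :
    y ^ α ≤ (1 / N) ^ (1 - α) * y := by
  have hy0 : 0 < y := hN.trans_le hy
  calc y ^ α = (1 / y) ^ (1 - α) * y := by
        rw [one_div, Real.inv_rpow hy0.le, ← Real.rpow_neg hy0.le]
        nth_rewrite 3 [← Real.rpow_one y]
        rw [← Real.rpow_add hy0]
        congr 1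
        ring
    _ ≤ (1 / N) ^ (1 - α) * y := by
        have : 0 ≤ 1 - α := sub_nonneg.2 hα
        gcongr

/-- Lemma 1, inequality (3): for an a.s. positive random variable `ξ` with `E[1/ξ] ≤ 1`,
`α ∈ (0,1)` and `M, N > 0`,
`E[ξ^{-α}] ≤ (1/M)^α + (1/N)^{1-α} + N^α · P(ξ < M)`. -/
theorem lintegral_rpow_neg_le {Ω : Type*} [MeasurableSpace Ω]
    (P : Measure Ω) [IsProbabilityMeasure P]
    (ξ : Ω → ℝ) (hmeas : Measurable ξ) (hpos : ∀ᵐ ω ∂P, 0 < ξ ω)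
    (hint : ∫⁻ ω, ENNReal.ofReal (ξ ω)⁻¹ ∂P ≤ 1)
    (α M N : ℝ) (hα : α ∈ Set.Ioo (0 : ℝ) 1) (hM : 0 < M) (hN : 0 < N) :
    ∫⁻ ω, ENNReal.ofReal (ξ ω ^ (-α)) ∂P ≤
      ENNReal.ofReal ((1 / M) ^ α) + ENNReal.ofReal ((1 / N) ^ (1 - α)) +
        ENNReal.ofReal (N ^ α) * P {ω | ξ ω < M} := by
  obtain ⟨hα0, hα1⟩ := hα
  have hS : MeasurableSet {ω | ξ ω < M} := measurableSet_lt hmeas measurable_const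
  have hpoint : ∀ᵐ ω ∂P, ENNReal.ofReal (ξ ω ^ (-α)) ≤
      ENNReal.ofReal ((1 / M) ^ α) +
        ENNReal.ofReal ((1 / N) ^ (1 - α)) * ENNReal.ofReal (ξ ω)⁻¹ +
        {ω | ξ ω < M}.indicator (fun _ => ENNReal.ofReal (N ^ α)) ω := by
    filter_upwards [hpos] with ω hω
    have hrw : ξ ω ^ (-α) = (ξ ω)⁻¹ ^ α := by
      rw [Real.rpow_neg hω.le, Real.inv_rpow hω.le]
    rw [hrw]
    rcases le_or_gt M (ξ ω) with h | h
    · refine le_add_right (le_add_right (ENNReal.ofReal_le_ofReal ?_))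
      rw [one_div]
      gcongr
    rcases le_total (ξ ω)⁻¹ N with h' | h'
    · rw [Set.indicator_of_mem (by exact h)]
      refine le_add_left (ENNReal.ofReal_le_ofReal ?_)
      gcongr
    · refine le_add_right (le_add_left ?_)
      rw [← ENNReal.ofReal_mul (by positivity)]
      exact ENNReal.ofReal_le_ofReal (Real.rpow_le_one_div_rpow_mul hα1.le hN h')
  refine (lintegral_mono_ae hpoint).trans ?_
  rw [lintegral_add_right _ (measurable_const.indicator hS), lintegral_add_left measurable_const,
    lintegral_const, measure_univ, mul_one, lintegral_const_mul' _ _ ofReal_ne_top,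
    lintegral_indicator_const hS]
  gcongr
  exact mul_le_of_le_one_right' hint
end

section
/- For each n ∈ ℕ, let (Ω_n, 𝓕_n, P_n) be a probability space and ζ_n a random variable on Ω_n with ζ_n > 0 P_n-almost surely and E_{P_n}[ζ_n] ≤ 1. Then lim_{α↓0} lim inf_{n→∞} E_{P_n}[(ζ_n)^α] exists and equals lim_{M→∞} lim inf_{n→∞} P_n((ζ_n)^{-1} < M) (the latter limit exists by monotonicity in M). In particular, the sequence ((ζ_n)^{-1} | P_n) is tight if and only if lim_{α↓0} lim inf_{n→∞} E_{P_n}[(ζ_n)^α] = 1. -/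
open MeasureTheory Filter Topology ENNReal

/-- The lower bound for `E[X ^ α]`: on `{X⁻¹ < M}` one has `X ^ α ≥ M ^ (-α)`. -/
theorem rpow_neg_mul_measure_inv_lt_le {Ω : Type*} [MeasurableSpace Ω] {μ : Measure Ω}
    {X : Ω → ℝ} (hX : Measurable X) (hpos : ∀ᵐ ω ∂μ, 0 < X ω) {α M : ℝ}
    (hα : 0 < α) (hM : 0 < M) :
    ENNReal.ofReal (M ^ (-α)) * μ {ω | (X ω)⁻¹ < M} ≤ ∫⁻ ω, ENNReal.ofReal (X ω ^ α) ∂μ := by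
  have hA : MeasurableSet {ω | (X ω)⁻¹ < M} := measurableSet_lt hX.inv measurable_const
  rw [← lintegral_indicator_const hA]
  refine lintegral_mono_ae ?_
  filter_upwards [hpos] with ω hω
  by_cases h : (X ω)⁻¹ < M
  · rw [Set.indicator_of_mem (by exact h), Real.rpow_neg hM.le, ← Real.inv_rpow hM.le]
    exact ENNReal.ofReal_le_ofReal
      (Real.rpow_le_rpow (inv_nonneg.2 hM.le) (inv_lt_of_inv_lt₀ hω h).le hα.le)
  · rw [Set.indicator_of_notMem (by exact h)]
    exact zero_le

/-- The upper bound for `E[X ^ α]`: from `x ^ α ≤ α x + (1 - α)`, applied on `{X⁻¹ < M}`, and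
`X ^ α ≤ M ^ (-α)` on the complement. -/
theorem lintegral_rpow_le_add_measure_inv_lt {Ω : Type*} [MeasurableSpace Ω] {μ : Measure Ω}
    [IsProbabilityMeasure μ] {X : Ω → ℝ} (hX : Measurable X) (hpos : ∀ᵐ ω ∂μ, 0 < X ω)
    (hint : ∫⁻ ω, ENNReal.ofReal (X ω) ∂μ ≤ 1) {α M : ℝ}
    (hα : 0 < α) (hα1 : α < 1) (hM : 0 < M) :
    ∫⁻ ω, ENNReal.ofReal (X ω ^ α) ∂μ ≤
      ENNReal.ofReal (M ^ (-α)) + ENNReal.ofReal α + μ {ω | (X ω)⁻¹ < M} := by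
  have hA : MeasurableSet {ω | (X ω)⁻¹ < M} := measurableSet_lt hX.inv measurable_const
  calc ∫⁻ ω, ENNReal.ofReal (X ω ^ α) ∂μ
      ≤ ∫⁻ ω, (ENNReal.ofReal (M ^ (-α)) + ENNReal.ofReal α * ENNReal.ofReal (X ω)
          + {ω | (X ω)⁻¹ < M}.indicator (fun _ => 1) ω) ∂μ := by
        refine lintegral_mono_ae ?_
        filter_upwards [hpos] with ω hω
        by_cases h : (X ω)⁻¹ < M
        · rw [Set.indicator_of_mem (by exact h), add_assoc]
          refine le_add_left ?_
          rw [← ENNReal.ofReal_mul hα.le, ← ENNReal.ofReal_one,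
            ← ENNReal.ofReal_add (by positivity) zero_le_one]
          refine ENNReal.ofReal_le_ofReal ?_
          have := Real.geom_mean_le_arith_mean2_weighted hα.le (sub_nonneg.2 hα1.le) hω.le
            zero_le_one (by ring)
          rw [Real.one_rpow] at this
          linarith
        · rw [add_assoc]
          refine le_add_right (ENNReal.ofReal_le_ofReal ?_)
          rw [Real.rpow_neg hM.le, ← Real.inv_rpow hM.le]
          exact Real.rpow_le_rpow hω.le ((le_inv_comm₀ hM hω).1 (not_lt.1 h)) hα.le
    _ = ENNReal.ofReal (M ^ (-α)) + ENNReal.ofReal α * ∫⁻ ω, ENNReal.ofReal (X ω) ∂μ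
          + μ {ω | (X ω)⁻¹ < M} := by
        rw [lintegral_add_right _ (measurable_const.indicator hA),
          lintegral_add_left measurable_const, lintegral_const_mul _ hX.ennreal_ofReal,
          lintegral_indicator_const hA]
        simp
    _ ≤ _ := by
        gcongr
        exact mul_le_of_le_one_right' hint

/-- Corollary 1: for a.s. positive random variables `ζ_n` with `E[ζ_n] ≤ 1`, the limit
`lim_{α↓0} liminf_n E[ζ_n^α]` exists and equals `lim_{M→∞} liminf_n P_n(ζ_n⁻¹ < M)`;
in particular `(ζ_n⁻¹ | P_n)` is tight iff the former limit equals `1`. -/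
theorem hellinger_limit_eq {Ω : ℕ → Type*} [∀ n, MeasurableSpace (Ω n)]
    (P : ∀ n, Measure (Ω n)) (hP : ∀ n, IsProbabilityMeasure (P n))
    (ζ : ∀ n, Ω n → ℝ) (hmeas : ∀ n, Measurable (ζ n))
    (hpos : ∀ n, ∀ᵐ ω ∂P n, 0 < ζ n ω)
    (hint : ∀ n, ∫⁻ ω, ENNReal.ofReal (ζ n ω) ∂P n ≤ 1) :
    (∃ L : ℝ≥0∞,
      Tendsto (fun α : ℝ =>
          liminf (fun n => ∫⁻ ω, ENNReal.ofReal (ζ n ω ^ α) ∂P n) atTop)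
        (𝓝[>] (0 : ℝ)) (𝓝 L) ∧
      Tendsto (fun M : ℝ =>
          liminf (fun n => P n {ω | (ζ n ω)⁻¹ < M}) atTop) atTop (𝓝 L)) ∧
    (Tendsto (fun M : ℝ =>
        limsup (fun n => P n {ω | M ≤ (ζ n ω)⁻¹}) atTop) atTop (𝓝 0) ↔
      Tendsto (fun α : ℝ =>
          liminf (fun n => ∫⁻ ω, ENNReal.ofReal (ζ n ω ^ α) ∂P n) atTop)
        (𝓝[>] (0 : ℝ)) (𝓝 1)) := by
  set F : ℝ → ℝ≥0∞ := fun α =>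
    liminf (fun n => ∫⁻ ω, ENNReal.ofReal (ζ n ω ^ α) ∂P n) atTop
  set G : ℝ → ℝ≥0∞ := fun M => liminf (fun n => P n {ω | (ζ n ω)⁻¹ < M}) atTop with hG
  have hG_mono : Monotone G := fun M M' h => liminf_le_liminf
    (Eventually.of_forall fun n => measure_mono fun ω (hω : _ < M) => hω.trans_le h)
  have hG_one : ∀ M, G M ≤ 1 := fun M =>
    (liminf_le_liminf (Eventually.of_forall fun n => prob_le_one)).trans (liminf_const 1).le
  have hG_tendsto : Tendsto G atTop (𝓝 (⨆ M, G M)) := tendsto_atTop_iSup hG_mono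
  have hF_upper : ∀ α : ℝ, 0 < α → α < 1 → F α ≤ ENNReal.ofReal α + ⨆ M, G M := by
    intro α hα hα1
    have hbound : ∀ M : ℝ, 0 < M → F α ≤ ENNReal.ofReal (M ^ (-α)) + ENNReal.ofReal α + G M := by
      intro M hM
      rw [hG, ← liminf_const_add atTop _ _ (by isBoundedDefault) (by isBoundedDefault)]
      exact liminf_le_liminf (Eventually.of_forall fun n =>
        lintegral_rpow_le_add_measure_inv_lt (hmeas n) (hpos n) (hint n) hα hα1 hM)
    have hlim : Tendsto (fun M : ℝ => ENNReal.ofReal (M ^ (-α)) + ENNReal.ofReal α + G M) atTop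
        (𝓝 (ENNReal.ofReal 0 + ENNReal.ofReal α + ⨆ M, G M)) :=
      ((ENNReal.tendsto_ofReal (tendsto_rpow_neg_atTop hα)).add tendsto_const_nhds).add hG_tendsto
    rw [ENNReal.ofReal_zero, zero_add] at hlim
    exact ge_of_tendsto hlim ((eventually_gt_atTop 0).mono hbound)
  have hF_lower : ∀ α M : ℝ, 0 < α → 0 < M → ENNReal.ofReal (M ^ (-α)) * G M ≤ F α := by
    intro α M hα hM
    have hmul : liminf (fun n => ENNReal.ofReal (M ^ (-α)) * P n {ω | (ζ n ω)⁻¹ < M}) atTop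
        = ENNReal.ofReal (M ^ (-α)) * G M :=
      ENNReal.liminf_const_mul_of_ne_top ENNReal.ofReal_ne_top
    rw [← hmul]
    exact liminf_le_liminf (Eventually.of_forall fun n =>
      rpow_neg_mul_measure_inv_lt_le (hmeas n) (hpos n) hα hM)
  have hF_tendsto : Tendsto F (𝓝[>] 0) (𝓝 (⨆ M, G M)) := by
    refine tendsto_of_le_liminf_of_limsup_le (iSup_le fun M => ?_) ?_
    · refine (hG_mono (le_max_left M 1)).trans ?_
      have hM : (0 : ℝ) < max M 1 := zero_lt_one.trans_le (le_max_right M 1)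
      have hpow : Tendsto (fun α : ℝ => max M 1 ^ (-α)) (𝓝[>] 0) (𝓝 1) := by
        have hcont : Continuous fun α : ℝ => max M 1 ^ (-α) :=
          continuous_const.rpow continuous_neg fun _ => Or.inl hM.ne'
        simpa using (hcont.tendsto 0).mono_left nhdsWithin_le_nhds
      have hlim : Tendsto (fun α : ℝ => ENNReal.ofReal (max M 1 ^ (-α)) * G (max M 1)) (𝓝[>] 0)
          (𝓝 (ENNReal.ofReal 1 * G (max M 1))) :=
        ENNReal.Tendsto.mul_const (ENNReal.tendsto_ofReal hpow) (Or.inl (by simp))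
      rw [ENNReal.ofReal_one, one_mul] at hlim
      rw [← hlim.liminf_eq]
      exact liminf_le_liminf (eventually_mem_nhdsWithin.mono fun α hα => hF_lower α _ hα hM)
    · have hlim : Tendsto (fun α : ℝ => ENNReal.ofReal α + ⨆ M, G M) (𝓝[>] 0)
          (𝓝 (ENNReal.ofReal 0 + ⨆ M, G M)) :=
        (ENNReal.tendsto_ofReal (tendsto_id.mono_left nhdsWithin_le_nhds)).add tendsto_const_nhds
      rw [ENNReal.ofReal_zero, zero_add] at hlim
      rw [← hlim.limsup_eq]
      refine limsup_le_limsup ?_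
      filter_upwards [Ioo_mem_nhdsGT one_pos] with α hα using hF_upper α hα.1 hα.2
  have htail : (fun M : ℝ => limsup (fun n => P n {ω | M ≤ (ζ n ω)⁻¹}) atTop)
      = fun M => 1 - G M := by
    funext M
    rw [hG, ← ENNReal.limsup_const_sub atTop _ ENNReal.one_ne_top]
    congr with n
    have hA : MeasurableSet {ω | (ζ n ω)⁻¹ < M} := measurableSet_lt (hmeas n).inv measurable_const
    rw [← prob_compl_eq_one_sub hA]
    congr with ω
    simp
  have htail_tendsto : Tendsto (fun M => 1 - G M) atTop (𝓝 (1 - ⨆ M, G M)) :=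
    ENNReal.Tendsto.sub tendsto_const_nhds hG_tendsto (Or.inl ENNReal.one_ne_top)
  refine ⟨⟨⨆ M, G M, hF_tendsto, hG_tendsto⟩, ?_⟩
  rw [htail]
  constructor
  · intro h
    have hL : 1 ≤ ⨆ M, G M := tsub_eq_zero_iff_le.1 (tendsto_nhds_unique htail_tendsto h)
    rwa [le_antisymm (iSup_le hG_one) hL] at hF_tendsto
  · intro h
    rw [tendsto_nhds_unique hF_tendsto h, tsub_self] at htail_tendsto
    exact htail_tendsto
end

section
/- For each n ∈ ℕ, let (Ω_n, 𝓕_n, P_n) be a probability space and V_n a random variable on Ω_n with V_n > 0 P_n-almost surely and E_{P_n}[1/V_n] ≤ 1. Then the following are equivalent: (a) lim sup_{n→∞} P_n(V_n ≥ M) = 1 for every M > 0; (b) lim inf_{n→∞} E_{P_n}[(V_n)^{-α}] = 0 for some α ∈ (0,1). -/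
open MeasureTheory Filter Topology ENNReal

lemma measure_lt_le_of_one_sub_le_measure_ge {Ω : Type*} [MeasurableSpace Ω] (μ : Measure Ω)
    [IsProbabilityMeasure μ] {V : Ω → ℝ} (hV : Measurable V) {M : ℝ} {ε : ℝ≥0∞}
    (h : 1 - ε ≤ μ {ω | M ≤ V ω}) : μ {ω | V ω < M} ≤ ε := by
  have hms : MeasurableSet {ω | M ≤ V ω} := measurableSet_le measurable_const hV
  have hc : {ω | V ω < M} = {ω | M ≤ V ω}ᶜ := by ext; simp
  rw [hc, prob_compl_eq_one_sub hms]
  rw [tsub_le_iff_right] at h ⊢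
  rwa [add_comm]

lemma one_sub_le_measure_ge_of_measure_lt_le {Ω : Type*} [MeasurableSpace Ω] (μ : Measure Ω)
    [IsProbabilityMeasure μ] {V : Ω → ℝ} (hV : Measurable V) {M : ℝ} {ε : ℝ≥0∞}
    (h : μ {ω | V ω < M} ≤ ε) : 1 - ε ≤ μ {ω | M ≤ V ω} := by
  have hms : MeasurableSet {ω | V ω < M} := measurableSet_lt hV measurable_const
  have hc : {ω | M ≤ V ω} = {ω | V ω < M}ᶜ := by ext; simp
  rw [hc, prob_compl_eq_one_sub hms]
  exact tsub_le_tsub_left h 1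

lemma rpow_neg_half_le_of_inv_sq_le {v t : ℝ} (hv : 0 < v) (ht : 0 < t) (h : (t ^ 2)⁻¹ ≤ v) :
    v ^ (-(1 / 2) : ℝ) ≤ t := by
  have hs : (v ^ (-(1 / 2) : ℝ)) ^ 2 = v⁻¹ := by
    rw [← Real.rpow_mul_natCast hv.le, ← Real.rpow_neg_one]; norm_num
  refine le_of_sq_le_sq ?_ ht.le
  rw [hs]
  exact inv_le_of_inv_le₀ (by positivity) h

lemma rpow_neg_half_le_mul_inv_add_inv {v t : ℝ} (hv : 0 < v) (ht : 0 < t) :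
    v ^ (-(1 / 2) : ℝ) ≤ t * v⁻¹ + t⁻¹ := by
  have hs : (v ^ (-(1 / 2) : ℝ)) ^ 2 = v⁻¹ := by
    rw [← Real.rpow_mul_natCast hv.le, ← Real.rpow_neg_one]; norm_num
  rw [← hs]
  set s := v ^ (-(1 / 2) : ℝ)
  have h1 : t * t⁻¹ = 1 := mul_inv_cancel₀ ht.ne'
  have h2 : 0 < t⁻¹ := by positivity
  have h3 : 0 ≤ t⁻¹ * ((t * s - 1) ^ 2 + t * s) := by
    have : 0 ≤ s := by positivity
    positivity
  have h4 : t⁻¹ * ((t * s - 1) ^ 2 + t * s) = t * s ^ 2 + t⁻¹ - s := by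
    field_simp; ring
  linarith

lemma lintegral_rpow_neg_half_le {Ω : Type*} [MeasurableSpace Ω] (μ : Measure Ω)
    [IsProbabilityMeasure μ] {V : Ω → ℝ} (hV : Measurable V) (hpos : ∀ᵐ ω ∂μ, 0 < V ω)
    (hint : ∫⁻ ω, ENNReal.ofReal (V ω)⁻¹ ∂μ ≤ 1) {t : ℝ} (ht : 0 < t)
    (h : μ {ω | V ω < (t ^ 2)⁻¹} ≤ ENNReal.ofReal (t ^ 2)) :
    ∫⁻ ω, ENNReal.ofReal (V ω ^ (-(1 / 2) : ℝ)) ∂μ ≤ ENNReal.ofReal (3 * t) := by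
  have hms : MeasurableSet {ω | V ω < (t ^ 2)⁻¹} := measurableSet_lt hV measurable_const
  calc ∫⁻ ω, ENNReal.ofReal (V ω ^ (-(1 / 2) : ℝ)) ∂μ
      ≤ ∫⁻ ω, (ENNReal.ofReal t + ENNReal.ofReal t * ENNReal.ofReal (V ω)⁻¹) +
          {ω | V ω < (t ^ 2)⁻¹}.indicator (fun _ => ENNReal.ofReal t⁻¹) ω ∂μ := by
        refine lintegral_mono_ae ?_
        filter_upwards [hpos] with ω hω
        rcases lt_or_ge (V ω) (t ^ 2)⁻¹ with hlt | hge
        · rw [Set.indicator_of_mem (by exact hlt), ← ENNReal.ofReal_mul ht.le, add_assoc,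
            ← ENNReal.ofReal_add (by positivity) (by positivity)]
          exact le_add_left (ENNReal.ofReal_le_ofReal (rpow_neg_half_le_mul_inv_add_inv hω ht))
        · rw [add_assoc]
          exact le_add_right
            (ENNReal.ofReal_le_ofReal (rpow_neg_half_le_of_inv_sq_le hω ht hge))
    _ = ENNReal.ofReal t + ENNReal.ofReal t * ∫⁻ ω, ENNReal.ofReal (V ω)⁻¹ ∂μ +
          ENNReal.ofReal t⁻¹ * μ {ω | V ω < (t ^ 2)⁻¹} := by
        rw [lintegral_add_right _ (measurable_const.indicator hms),
          lintegral_add_left measurable_const, lintegral_const_mul _ (by fun_prop),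
          lintegral_indicator_const hms]
        simp
    _ ≤ ENNReal.ofReal t + ENNReal.ofReal t * 1 +
          ENNReal.ofReal t⁻¹ * ENNReal.ofReal (t ^ 2) := by gcongr
    _ = ENNReal.ofReal (3 * t) := by
        rw [mul_one, ← ENNReal.ofReal_mul (by positivity), ← ENNReal.ofReal_add ht.le ht.le,
          ← ENNReal.ofReal_add (by positivity) (by positivity)]
        congr 1
        field_simp; ring

lemma measure_lt_le_mul_lintegral_rpow_neg {Ω : Type*} [MeasurableSpace Ω] (μ : Measure Ω)
    {V : Ω → ℝ} (hV : Measurable V) (hpos : ∀ᵐ ω ∂μ, 0 < V ω) {α M : ℝ} (hα : 0 < α)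
    (hM : 0 < M) :
    μ {ω | V ω < M} ≤
      ENNReal.ofReal (M ^ α) * ∫⁻ ω, ENNReal.ofReal (V ω ^ (-α)) ∂μ := by
  have hms : MeasurableSet {ω | V ω < M} := measurableSet_lt hV measurable_const
  rw [← lintegral_const_mul _ (by fun_prop), ← lintegral_indicator_one hms]
  refine lintegral_mono_ae ?_
  filter_upwards [hpos] with ω hω
  by_cases hlt : V ω < M
  · rw [Set.indicator_of_mem (by exact hlt), ← ENNReal.ofReal_mul (by positivity), Pi.one_apply,
      ENNReal.one_le_ofReal, Real.rpow_neg hω.le, ← div_eq_mul_inv,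
      one_le_div (Real.rpow_pos_of_pos hω α)]
    exact Real.rpow_le_rpow hω.le hlt.le hα.le
  · rw [Set.indicator_of_notMem (by exact hlt)]
    exact zero_le

theorem limsup_prob_ge_one_iff {Ω : ℕ → Type*} [∀ n, MeasurableSpace (Ω n)]
    (P : ∀ n, Measure (Ω n)) (hP : ∀ n, IsProbabilityMeasure (P n))
    (V : ∀ n, Ω n → ℝ) (hmeas : ∀ n, Measurable (V n))
    (hpos : ∀ n, ∀ᵐ ω ∂P n, 0 < V n ω)
    (hint : ∀ n, ∫⁻ ω, ENNReal.ofReal (V n ω)⁻¹ ∂P n ≤ 1) :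
    (∀ M : ℝ, 0 < M → limsup (fun n => P n {ω | M ≤ V n ω}) atTop = 1) ↔
      ∃ α ∈ Set.Ioo (0 : ℝ) 1,
        liminf (fun n => ∫⁻ ω, ENNReal.ofReal (V n ω ^ (-α)) ∂P n) atTop = 0 := by
  constructor
  · intro h
    refine ⟨1 / 2, ⟨by norm_num, by norm_num⟩, ?_⟩
    have key : ∀ t : ℝ, 0 < t →
        liminf (fun n => ∫⁻ ω, ENNReal.ofReal (V n ω ^ (-(1 / 2) : ℝ)) ∂P n) atTop ≤
          ENNReal.ofReal (3 * t) := by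
      intro t ht
      have hlt : 1 - ENNReal.ofReal (t ^ 2) <
          limsup (fun n => P n {ω | (t ^ 2)⁻¹ ≤ V n ω}) atTop := by
        rw [h _ (by positivity)]
        exact ENNReal.sub_lt_self one_ne_top one_ne_zero (by positivity)
      refine liminf_le_of_frequently_le' ((frequently_lt_of_lt_limsup (by isBoundedDefault)
        hlt).mono fun n hn => ?_)
      exact lintegral_rpow_neg_half_le (P n) (hmeas n) (hpos n) (hint n) ht
        (measure_lt_le_of_one_sub_le_measure_ge (P n) (hmeas n) hn.le)
    refine le_antisymm (ENNReal.le_of_forall_pos_le_add fun ε hε _ => ?_) zero_le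
    have hε' : (0 : ℝ) < ε / 3 := by positivity
    simpa [mul_div_cancel₀] using key _ hε'
  · rintro ⟨α, ⟨hα, -⟩, h⟩ M hM
    refine le_antisymm (limsup_le_of_le (by isBoundedDefault)
      (Eventually.of_forall fun n => prob_le_one)) ?_
    refine ENNReal.le_of_forall_pos_le_add fun ε hε _ => ?_
    have hC : 0 < M ^ α := Real.rpow_pos_of_pos hM α
    have hlt : liminf (fun n => ∫⁻ ω, ENNReal.ofReal (V n ω ^ (-α)) ∂P n) atTop <
        ε / ENNReal.ofReal (M ^ α) := by
      rw [h]
      exact ENNReal.div_pos (by exact_mod_cast hε.ne') ofReal_ne_top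
    rw [← tsub_le_iff_right]
    refine le_limsup_of_frequently_le' ((frequently_lt_of_liminf_lt (by isBoundedDefault)
      hlt).mono fun n hn => ?_)
    refine one_sub_le_measure_ge_of_measure_lt_le (P n) (hmeas n)
      ((measure_lt_le_mul_lintegral_rpow_neg (P n) (hmeas n) (hpos n) hα hM).trans ?_)
    rw [mul_comm]
    exact ENNReal.mul_le_of_le_div hn.le
end

section
/- For each n ∈ ℕ, let (Ω_n, 𝓕_n, P_n) be a probability space and let X_n, V_n, ζ_n be random variables on Ω_n with X_n ≥ 0, V_n > 0 and ζ_n > 0 P_n-a.s., satisfying E_{P_n}[X_n/V_n] ≤ 1 and E_{P_n}[V_n·ζ_n] ≤ 1. Then for all M > 0 and N > 0: lim sup_{n→∞} P_n(X_n ≥ M) ≤ N/M + lim sup_{n→∞} P_n(V_n ≥ N), and lim sup_{n→∞} P_n(V_n ≥ M) ≤ N/M + lim sup_{n→∞} P_n(1/ζ_n ≥ N). In particular, if the sequence ((ζ_n)^{-1} | P_n) is tight then the sequence (V_n | P_n) is tight. -/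
open MeasureTheory Filter Topology ENNReal

/-- Markov's inequality applied to a ratio `f / g` with `∫ f / g ≤ 1`, split according to the
size of the denominator. -/
lemma measure_le_add_of_lintegral_div_le_one {Ω : Type*} [MeasurableSpace Ω] {μ : Measure Ω}
    {f g : Ω → ℝ} (hf : Measurable f) (hg : Measurable g) (hpos : ∀ᵐ ω ∂μ, 0 < g ω)
    (hint : ∫⁻ ω, ENNReal.ofReal (f ω / g ω) ∂μ ≤ 1) {M N : ℝ} (hM : 0 < M) (hN : 0 < N) :
    μ {ω | M ≤ f ω} ≤ ENNReal.ofReal (N / M) + μ {ω | N ≤ g ω} := by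
  have hMN : 0 < M / N := div_pos hM hN
  calc μ {ω | M ≤ f ω}
      ≤ μ ({ω | ENNReal.ofReal (M / N) ≤ ENNReal.ofReal (f ω / g ω)} ∪ {ω | N ≤ g ω}) := by
        refine measure_mono_ae ?_
        filter_upwards [hpos] with ω hω (hMf : M ≤ f ω)
        rcases le_or_gt N (g ω) with h | h
        · exact Or.inr h
        · exact Or.inl (ENNReal.ofReal_le_ofReal
            (div_le_div₀ (hM.le.trans hMf) hMf hω h.le))
    _ ≤ μ {ω | ENNReal.ofReal (M / N) ≤ ENNReal.ofReal (f ω / g ω)} + μ {ω | N ≤ g ω} :=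
        measure_union_le _ _
    _ ≤ ENNReal.ofReal (N / M) + μ {ω | N ≤ g ω} := by
        gcongr
        calc μ {ω | ENNReal.ofReal (M / N) ≤ ENNReal.ofReal (f ω / g ω)}
            ≤ (∫⁻ ω, ENNReal.ofReal (f ω / g ω) ∂μ) / ENNReal.ofReal (M / N) :=
              meas_ge_le_lintegral_div (hf.div hg).ennreal_ofReal.aemeasurable
                (ENNReal.ofReal_pos.2 hMN).ne' ENNReal.ofReal_ne_top
          _ ≤ 1 / ENNReal.ofReal (M / N) := by gcongr
          _ = ENNReal.ofReal (N / M) := by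
              rw [one_div, ← ENNReal.ofReal_inv_of_pos hMN, inv_div]

/-- A uniform version along a sequence of
`measure_le_add_of_lintegral_div_le_one`, passing to the upper limit. -/
lemma limsup_measure_le_add_of_lintegral_div_le_one {Ω : ℕ → Type*}
    [∀ n, MeasurableSpace (Ω n)] {P : ∀ n, Measure (Ω n)} {f g : ∀ n, Ω n → ℝ}
    (hf : ∀ n, Measurable (f n)) (hg : ∀ n, Measurable (g n))
    (hpos : ∀ n, ∀ᵐ ω ∂P n, 0 < g n ω)
    (hint : ∀ n, ∫⁻ ω, ENNReal.ofReal (f n ω / g n ω) ∂P n ≤ 1)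
    {M N : ℝ} (hM : 0 < M) (hN : 0 < N) :
    limsup (fun n => P n {ω | M ≤ f n ω}) atTop ≤
      ENNReal.ofReal (N / M) + limsup (fun n => P n {ω | N ≤ g n ω}) atTop := by
  calc limsup (fun n => P n {ω | M ≤ f n ω}) atTop
      ≤ limsup (fun n => ENNReal.ofReal (N / M) + P n {ω | N ≤ g n ω}) atTop :=
        limsup_le_limsup (Eventually.of_forall fun n =>
          measure_le_add_of_lintegral_div_le_one (hf n) (hg n) (hpos n) (hint n) hM hN)
    _ = ENNReal.ofReal (N / M) + limsup (fun n => P n {ω | N ≤ g n ω}) atTop :=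
        limsup_const_add atTop _ _ (by isBoundedDefault) (by isBoundedDefault)

/-- Corollary 3: if `E[X_n/V_n] ≤ 1` and `E[V_n·ζ_n] ≤ 1`, then
`limsup P_n(X_n ≥ M) ≤ N/M + limsup P_n(V_n ≥ N)` and
`limsup P_n(V_n ≥ M) ≤ N/M + limsup P_n(1/ζ_n ≥ N)` for all `M, N > 0`;
in particular tightness of `(ζ_n⁻¹ | P_n)` implies tightness of `(V_n | P_n)`. -/
theorem limsup_prob_estimates {Ω : ℕ → Type*} [∀ n, MeasurableSpace (Ω n)]
    (P : ∀ n, Measure (Ω n)) (hP : ∀ n, IsProbabilityMeasure (P n))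
    (X V ζ : ∀ n, Ω n → ℝ)
    (hXmeas : ∀ n, Measurable (X n)) (hVmeas : ∀ n, Measurable (V n))
    (hζmeas : ∀ n, Measurable (ζ n))
    (hXnonneg : ∀ n ω, 0 ≤ X n ω)
    (hVpos : ∀ n, ∀ᵐ ω ∂P n, 0 < V n ω)
    (hζpos : ∀ n, ∀ᵐ ω ∂P n, 0 < ζ n ω)
    (hintXV : ∀ n, ∫⁻ ω, ENNReal.ofReal (X n ω / V n ω) ∂P n ≤ 1)
    (hintVζ : ∀ n, ∫⁻ ω, ENNReal.ofReal (V n ω * ζ n ω) ∂P n ≤ 1) :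
    (∀ M N : ℝ, 0 < M → 0 < N →
      limsup (fun n => P n {ω | M ≤ X n ω}) atTop ≤
        ENNReal.ofReal (N / M) + limsup (fun n => P n {ω | N ≤ V n ω}) atTop) ∧
    (∀ M N : ℝ, 0 < M → 0 < N →
      limsup (fun n => P n {ω | M ≤ V n ω}) atTop ≤
        ENNReal.ofReal (N / M) + limsup (fun n => P n {ω | N ≤ (ζ n ω)⁻¹}) atTop) ∧
    (Tendsto (fun M : ℝ =>
        limsup (fun n => P n {ω | M ≤ (ζ n ω)⁻¹}) atTop) atTop (𝓝 0) →
      Tendsto (fun M : ℝ =>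
        limsup (fun n => P n {ω | M ≤ V n ω}) atTop) atTop (𝓝 0)) := by
  have hζ : ∀ M N : ℝ, 0 < M → 0 < N →
      limsup (fun n => P n {ω | M ≤ V n ω}) atTop ≤
        ENNReal.ofReal (N / M) + limsup (fun n => P n {ω | N ≤ (ζ n ω)⁻¹}) atTop :=
    fun M N hM hN => limsup_measure_le_add_of_lintegral_div_le_one hVmeas
      (fun n => (hζmeas n).inv) (fun n => (hζpos n).mono fun _ h => inv_pos.2 h)
      (by simpa only [div_inv_eq_mul, Pi.inv_apply] using hintVζ) hM hN
  refine ⟨fun M N hM hN => limsup_measure_le_add_of_lintegral_div_le_one hXmeas hVmeas hVpos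
    hintXV hM hN, hζ, fun htight => ?_⟩
  have hratio : Tendsto (fun M : ℝ => ENNReal.ofReal (√M / M)) atTop (𝓝 0) := by
    simp only [Real.sqrt_div_self']
    simpa using ENNReal.tendsto_ofReal (Real.tendsto_sqrt_atTop.const_div_atTop 1)
  refine tendsto_of_tendsto_of_tendsto_of_le_of_le' tendsto_const_nhds
    (by simpa using hratio.add (htight.comp Real.tendsto_sqrt_atTop))
    (Eventually.of_forall fun _ => zero_le) ?_
  filter_upwards [eventually_gt_atTop 0] with M hM
  exact hζ M √M hM (Real.sqrt_pos.2 hM)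
end

section
/- Let μ ∈ ℝ, σ > 0, and let ξ be a standard Gaussian random variable on a probability space (Ω, 𝓕, P). Set R = exp(μ − σ²/2 + σξ) − 1, and define ζ = 1 if μ ≤ 0; ζ = exp(−(1/2)(μ/σ)² − (μ/σ)ξ) if 0 < μ ≤ σ²; and ζ = exp(−μ + σ²/2 − σξ) if μ > σ². Then for every δ ∈ [0,1]: E[(1 + δR)·ζ] ≤ 1. -/
open MeasureTheory ProbabilityTheory ENNReal

theorem lintegral_ofReal_exp_affine_gaussian {Ω : Type*} [MeasurableSpace Ω] {P : Measure Ω}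
    {ξ : Ω → ℝ} (hmeas : Measurable ξ) (hgauss : Measure.map ξ P = gaussianReal 0 1) (a b : ℝ) :
    ∫⁻ ω, ENNReal.ofReal (Real.exp (a + b * ξ ω)) ∂P = ENNReal.ofReal (Real.exp (a + b ^ 2 / 2)) := by
  have hint : Integrable (fun ω ↦ Real.exp (b * ξ ω)) P := by
    have h := integrable_exp_mul_gaussianReal (μ := 0) (v := 1) b
    rw [← hgauss] at h
    exact h.comp_measurable hmeas
  have hmgf : ∫ ω, Real.exp (b * ξ ω) ∂P = Real.exp (b ^ 2 / 2) := by
    simpa [mgf] using mgf_gaussianReal hgauss b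
  simp_rw [Real.exp_add a]
  rw [← ofReal_integral_eq_lintegral_ofReal (hint.const_mul _)
    (Filter.Eventually.of_forall fun ω ↦ by positivity), integral_const_mul, hmgf]

theorem lintegral_ofReal_convex_comb_exp_gaussian_le_one {Ω : Type*} [MeasurableSpace Ω]
    {P : Measure Ω} {ξ : Ω → ℝ} (hmeas : Measurable ξ)
    (hgauss : Measure.map ξ P = gaussianReal 0 1) {δ : ℝ} (hδ : δ ∈ Set.Icc (0 : ℝ) 1)
    {a b c d : ℝ} (hab : a + b ^ 2 / 2 ≤ 0) (hcd : c + d ^ 2 / 2 ≤ 0) :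
    ∫⁻ ω, ENNReal.ofReal ((1 - δ) * Real.exp (a + b * ξ ω) + δ * Real.exp (c + d * ξ ω)) ∂P
      ≤ 1 := by
  obtain ⟨h0, h1⟩ := hδ
  have h1' : 0 ≤ 1 - δ := sub_nonneg.2 h1
  have hsplit (ω : Ω) :
      ENNReal.ofReal ((1 - δ) * Real.exp (a + b * ξ ω) + δ * Real.exp (c + d * ξ ω)) =
        ENNReal.ofReal (1 - δ) * ENNReal.ofReal (Real.exp (a + b * ξ ω)) +
          ENNReal.ofReal δ * ENNReal.ofReal (Real.exp (c + d * ξ ω)) := by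
    rw [ENNReal.ofReal_add (by positivity) (by positivity), ENNReal.ofReal_mul h1',
      ENNReal.ofReal_mul h0]
  simp_rw [hsplit]
  rw [lintegral_add_left (by fun_prop), lintegral_const_mul _ (by fun_prop),
    lintegral_const_mul _ (by fun_prop), lintegral_ofReal_exp_affine_gaussian hmeas hgauss,
    lintegral_ofReal_exp_affine_gaussian hmeas hgauss, ← ENNReal.ofReal_mul h1',
    ← ENNReal.ofReal_mul h0, ← ENNReal.ofReal_add (by positivity) (by positivity)]
  refine ENNReal.ofReal_le_one.2 ?_
  nlinarith [Real.exp_le_one_iff.2 hab, Real.exp_le_one_iff.2 hcd]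

/-- The one-step supermartingale density bound in Lemma 4(a): with `R` the log-normal
return and `ζ` defined piecewise according to the sign/size of the drift `μ`, one has
`E[(1 + δR)·ζ] ≤ 1` for every fraction `δ ∈ [0,1]`. -/
theorem one_step_density_bound {Ω : Type*} [MeasurableSpace Ω]
    (P : Measure Ω) [IsProbabilityMeasure P]
    (μ σ : ℝ) (hσ : 0 < σ)
    (ξ : Ω → ℝ) (hmeas : Measurable ξ)
    (hgauss : Measure.map ξ P = gaussianReal 0 1)
    (R ζ : Ω → ℝ)
    (hR : ∀ ω, R ω = Real.exp (μ - σ ^ 2 / 2 + σ * ξ ω) - 1)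
    (hζ : ∀ ω, ζ ω =
      if μ ≤ 0 then 1
      else if μ ≤ σ ^ 2 then Real.exp (-(1 / 2) * (μ / σ) ^ 2 - (μ / σ) * ξ ω)
      else Real.exp (-μ + σ ^ 2 / 2 - σ * ξ ω))
    (δ : ℝ) (hδ : δ ∈ Set.Icc (0 : ℝ) 1) :
    ∫⁻ ω, ENNReal.ofReal ((1 + δ * R ω) * ζ ω) ∂P ≤ 1 := by
  obtain ⟨a, b, hζ', hab, hcd⟩ : ∃ a b : ℝ, (∀ ω, ζ ω = Real.exp (a + b * ξ ω)) ∧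
      a + b ^ 2 / 2 ≤ 0 ∧ (a + (μ - σ ^ 2 / 2)) + (b + σ) ^ 2 / 2 ≤ 0 := by
    by_cases h1 : μ ≤ 0
    · exact ⟨0, 0, fun ω ↦ by simp [hζ ω, h1], by norm_num, by linarith⟩
    by_cases h2 : μ ≤ σ ^ 2
    · refine ⟨-(1 / 2) * (μ / σ) ^ 2, -(μ / σ), fun ω ↦ ?_, by linarith, ?_⟩
      · rw [hζ ω, if_neg h1, if_pos h2]
        ring_nf
      · have hm : μ / σ * σ = μ := div_mul_cancel₀ μ hσ.ne'
        linarith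
    · refine ⟨-μ + σ ^ 2 / 2, -σ, fun ω ↦ ?_, by linarith, by linarith⟩
      rw [hζ ω, if_neg h1, if_neg h2]
      ring_nf
  have hrw (ω : Ω) : (1 + δ * R ω) * ζ ω = (1 - δ) * Real.exp (a + b * ξ ω) +
      δ * Real.exp ((a + (μ - σ ^ 2 / 2)) + (b + σ) * ξ ω) := by
    have hexp : (a + (μ - σ ^ 2 / 2)) + (b + σ) * ξ ω =
        (a + b * ξ ω) + (μ - σ ^ 2 / 2 + σ * ξ ω) := by ring
    rw [hR, hζ', hexp, Real.exp_add (a + b * ξ ω)]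
    ring
  simp_rw [hrw]
  exact lintegral_ofReal_convex_comb_exp_gaussian_le_one hmeas hgauss hδ hab hcd
end
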